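/- arXiv:2007.07464 — 5 statements merged into one kernel-verified Lean document; each statement's English description precedes it below -/
import Mathlib

section
/- For every n ≥ 15, there exists a graph G on n vertices that is strongly chordal and Hamiltonian but is not cycle extendible. -/
/-- A graph is chordal if it has no induced cycle of length at least 4. -/
def IsChordal {V : Type*} (G : SimpleGraph V) : Prop :=
  ∀ n, 4 ≤ n → IsEmpty (SimpleGraph.cycleGraph n ↪g G)

/-- A graph is strongly chordal if it is chordal and every even cycle of length at
least 6 has a chord joining two vertices at odd distance from each other along the
cycle. -/
def IsStronglyChordal {V : Type*} (G : SimpleGraph V) : Prop :=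
  IsChordal G ∧ ∀ (v : V) (c : G.Walk v v), c.IsCycle → 6 ≤ c.length → Even c.length →
    ∃ i j, i < j ∧ j < c.length ∧ Odd (j - i) ∧ j - i ≠ 1 ∧ ¬(i = 0 ∧ j = c.length - 1) ∧
      G.Adj (c.getVert i) (c.getVert j)

/-- A graph is cycle extendible if every non-spanning cycle `C` extends to a cycle
`C'` with `V(C) ⊂ V(C')` and `|V(C')| = |V(C)| + 1`. -/
def CycleExtendible {V : Type*} [Fintype V] [DecidableEq V] (G : SimpleGraph V) : Prop :=
  ∀ (a : V) (c : G.Walk a a), c.IsCycle → c.support.toFinset ≠ Finset.univ →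
    ∃ (b : V) (c' : G.Walk b b), c'.IsCycle ∧ c.support.toFinset ⊂ c'.support.toFinset ∧
      c'.support.toFinset.card = c.support.toFinset.card + 1
open SimpleGraph

/-- If a graph carries a rank function for which the closed adjacency matrix is Gamma-free,
it is strongly chordal. -/
theorem stronglyChordal_of_gammaFree {V : Type*} (G : SimpleGraph V) (r : V → ℕ)
    (A : V → V → Prop) (hA : ∀ i j, A i j ↔ i = j ∨ G.Adj i j)
    (hr : ∀ i j k l, r i ≤ r j → r k ≤ r l → A i k → A i l → A j k → A j l) :
    IsStronglyChordal G := by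
  constructor
  · intro n hn
    obtain ⟨m, rfl⟩ : ∃ m, n = m + 4 := ⟨n - 4, by omega⟩
    constructor
    intro e
    obtain ⟨i, -, hi⟩ := Finset.exists_min_image (Finset.univ : Finset (Fin (m + 4)))
      (fun t => r (e t)) ⟨0, Finset.mem_univ _⟩
    have h1 : A (e i) (e (i + 1)) := (hA _ _).2 (Or.inr (e.map_rel_iff.2 (by
      rw [cycleGraph_adj]; right; simp)))
    have h2 : A (e i) (e (i - 1)) := (hA _ _).2 (Or.inr (e.map_rel_iff.2 (by
      rw [cycleGraph_adj]; left; simp)))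
    have key : A (e (i + 1)) (e (i - 1)) := by
      rcases le_total (r (e (i + 1))) (r (e (i - 1))) with h | h
      · exact hr _ _ _ _ (hi _ (Finset.mem_univ _)) h h1 h2 ((hA _ _).2 (Or.inl rfl))
      · have := hr _ _ _ _ (hi _ (Finset.mem_univ _)) h h2 h1 ((hA _ _).2 (Or.inl rfl))
        rw [hA] at this ⊢
        rcases this with h | h
        · exact Or.inl h.symm
        · exact Or.inr h.symm
    have h1v : ((1 : Fin (m + 4)) : ℕ) = 1 := by
      simp
    have h2v : ((1 + 1 : Fin (m + 4)) : ℕ) = 2 := by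
      rw [Fin.val_add, h1v, Nat.mod_eq_of_lt (by omega)]
    have h3v : ((1 + 1 + 1 : Fin (m + 4)) : ℕ) = 3 := by
      rw [Fin.val_add, h2v, h1v, Nat.mod_eq_of_lt (by omega)]
    have hd : i + 1 - (i - 1) = 1 + 1 := by abel
    rw [hA] at key
    rcases key with h | h
    · have h := e.injective h
      rw [h, sub_self] at hd
      rw [← hd] at h2v
      simp at h2v
    · have h := e.map_rel_iff.1 h
      rw [cycleGraph_adj] at h
      rcases h with h | h
      · rw [← hd, h, h1v] at h2v
        omega
      · have hd' : i + 1 - (i - 1) + (i - 1 - (i + 1)) = 0 := by abel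
        rw [hd, h] at hd'
        rw [hd'] at h3v
        simp at h3v
  · intro v c hc hL hev
    set L := c.length with hLdef
    let w : ℕ → V := fun i => c.getVert (i % L)
    have hw : ∀ i, G.Adj (w i) (w (i + 1)) := by
      intro i
      have hlt : i % L < L := Nat.mod_lt _ (by omega)
      have := c.adj_getVert_succ hlt
      by_cases h : i % L + 1 = L
      · have h2 : (i + 1) % L = 0 := by
          rw [Nat.add_mod, Nat.mod_eq_of_lt (by omega : 1 < L), h, Nat.mod_self]
        simp only [w, h2]
        rw [h, hLdef, c.getVert_length] at this
        simpa using this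
      · have h2 : (i + 1) % L = i % L + 1 := by
          rw [Nat.add_mod, Nat.mod_eq_of_lt (by omega : 1 < L), Nat.mod_eq_of_lt (by omega)]
        simp only [w, h2]
        exact this
    have hinj : ∀ i j, i < L → j < L → c.getVert i = c.getVert j → i = j := by
      intro i j hi hj h
      exact hc.getVert_injOn' (by simp only [Set.mem_ofPred_eq]; omega)
        (by simp only [Set.mem_ofPred_eq]; omega) h
    obtain ⟨t, ht, hmin⟩ := Finset.exists_min_image ((Finset.range L).filter Even)
      (fun t => r (w t)) ⟨0, by simp; omega⟩
    have hmin' : ∀ s, Even s → r (w t) ≤ r (w s) := by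
      intro s hs
      have := hmin (s % L) (by
        simp only [Finset.mem_filter, Finset.mem_range]
        refine ⟨Nat.mod_lt _ (by omega), ?_⟩
        rw [Nat.even_iff] at *
        rw [Nat.mod_mod_of_dvd _ (Nat.dvd_of_mod_eq_zero hev)]
        exact hs)
      simpa [w] using this
    have hte : Even t := (Finset.mem_filter.1 ht).2
    have htL : w (t + L) = w t := by simp [w]
    obtain ⟨u, hu⟩ : ∃ u, t + L = u + 2 := ⟨t + L - 2, by omega⟩
    have hue : Even u := by
      rw [Nat.even_iff] at *; omega
    rw [hu] at htL
    have a0 := hw u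
    have a1 := hw (u + 1)
    have a2 := hw (u + 2)
    have a3 := hw (u + 3)
    have hm1 : r (w (u + 2)) ≤ r (w u) := by rw [htL]; exact hmin' _ hue
    have hm2 : r (w (u + 2)) ≤ r (w (u + 4)) := by
      rw [htL]; exact hmin' _ (by rw [Nat.even_iff] at *; omega)
    have key : ∃ s, A (w s) (w (s + 3)) := by
      rcases le_total (r (w (u + 1))) (r (w (u + 3))) with h | h
      · exact ⟨u, hr _ _ _ _ hm1 h ((hA _ _).2 (Or.inr a1.symm)) ((hA _ _).2 (Or.inr a2))
          ((hA _ _).2 (Or.inr a0))⟩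
      · refine ⟨u + 1, ?_⟩
        have := hr _ _ _ _ hm2 h ((hA _ _).2 (Or.inr a2)) ((hA _ _).2 (Or.inr a1.symm))
          ((hA _ _).2 (Or.inr a3.symm))
        rw [hA] at this ⊢
        rcases this with h | h
        · exact Or.inl h.symm
        · exact Or.inr h.symm
    obtain ⟨s, hs⟩ := key
    have hp : s % L < L := Nat.mod_lt _ (by omega)
    have hq : (s + 3) % L = if s % L + 3 < L then s % L + 3 else s % L + 3 - L := by
      rw [Nat.add_mod, Nat.mod_eq_of_lt (by omega : 3 < L)]
      split_ifs with h
      · exact Nat.mod_eq_of_lt h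
      · rw [Nat.mod_eq_sub_mod (by omega), Nat.mod_eq_of_lt (by omega)]
    rw [hA] at hs
    simp only [w] at hs
    rw [hq] at hs
    rw [Nat.even_iff] at hev
    split_ifs at hs with h
    · rcases hs with hs | hs
      · have := hinj _ _ hp h hs; omega
      · refine ⟨s % L, s % L + 3, by omega, h, ?_, by omega, by omega, hs⟩
        rw [Nat.odd_iff]; omega
    · rcases hs with hs | hs
      · have := hinj _ _ hp (by omega) hs; omega
      · refine ⟨s % L + 3 - L, s % L, by omega, hp, ?_, by omega, by omega, hs.symm⟩
        rw [Nat.odd_iff]; omega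

/-- Rows of the closed adjacency matrix of the base graph, as bit masks. -/
def baseRows : List ℕ := [18507, 2895, 14, 27487, 10360, 112, 27643, 448, 3018, 3914, 3584, 32603, 14336, 30808, 26697]

/-- Closed adjacency of the base graph. -/
def baseAdj (i j : ℕ) : Bool := (baseRows.getD i 0).testBit j

/-- Rank of the vertices in a strong elimination ordering. -/
def baseRank (i : ℕ) : ℕ := [7, 10, 2, 11, 4, 0, 9, 1, 8, 12, 14, 13, 3, 5, 6].getD i 0

theorem base_gammaFree_bool : ((List.range 15).all fun i => (List.range 15).all fun k =>
    !baseAdj i k || (List.range 15).all fun l =>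
    !(baseAdj i l && Nat.ble (baseRank k) (baseRank l)) || (List.range 15).all fun j =>
    !(baseAdj j k && Nat.ble (baseRank i) (baseRank j)) || baseAdj j l) = true := by
  decide +kernel

theorem base_gammaFree (i j k l : ℕ) (hi : i < 15) (hj : j < 15) (hk : k < 15) (hl : l < 15)
    (hij : baseRank i ≤ baseRank j) (hkl : baseRank k ≤ baseRank l)
    (h1 : baseAdj i k) (h2 : baseAdj i l) (h3 : baseAdj j k) : baseAdj j l := by
  have h := base_gammaFree_bool
  rw [List.all_eq_true] at h
  have h := h i (List.mem_range.2 hi)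
  rw [List.all_eq_true] at h
  have h := h k (List.mem_range.2 hk)
  rw [h1, Bool.not_true, Bool.false_or, List.all_eq_true] at h
  have h := h l (List.mem_range.2 hl)
  rw [h2, Nat.ble_eq_true_of_le hkl, Bool.and_true, Bool.not_true, Bool.false_or,
    List.all_eq_true] at h
  have h := h j (List.mem_range.2 hj)
  rw [h3, Nat.ble_eq_true_of_le hij, Bool.and_true, Bool.not_true, Bool.false_or] at h
  exact h

theorem baseAdj_symm (i j : ℕ) (hi : i < 15) (hj : j < 15) : baseAdj i j = baseAdj j i := by
  have : ∀ i < 15, ∀ j < 15, baseAdj i j = baseAdj j i := by decide +kernel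
  exact this i hi j hj

theorem baseAdj_refl (i : ℕ) (hi : i < 15) : baseAdj i i = true := by
  have : ∀ i < 15, baseAdj i i = true := by decide +kernel
  exact this i hi

theorem baseAdj_succ (i : ℕ) (hi : i < 14) : baseAdj i (i + 1) = true := by
  have : ∀ i < 14, baseAdj i (i + 1) = true := by decide +kernel
  exact this i hi

/-- Depth-first search for a path from `cur` through all of `rem` and then to vertex `2`. -/
def pathSearch : ℕ → ℕ → List ℕ → Bool
  | 0, cur, _ => baseAdj cur 2
  | k + 1, cur, rem => rem.any fun w => baseAdj cur w && pathSearch k w (rem.erase w)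

theorem pathSearch_sound (m : List ℕ) : ∀ (cur : ℕ) (rem : List ℕ), rem.Perm m →
    List.IsChain (fun a b => baseAdj a b = true) (cur :: (m ++ [2])) →
    pathSearch m.length cur rem = true := by
  induction m with
  | nil =>
    intro cur rem _ h
    simpa [pathSearch] using h
  | cons w m ih =>
    intro cur rem hp h
    rw [List.cons_append, List.isChain_cons_cons] at h
    simp only [List.length_cons, pathSearch, List.any_eq_true, Bool.and_eq_true]
    refine ⟨w, hp.mem_iff.2 (by simp), h.1, ih _ _ ?_ h.2⟩
    simpa using hp.erase w

theorem no_path_zero : pathSearch 13 2 [0, 1, 3, 4, 5, 6, 7, 8, 9, 10, 11, 12, 13] = false := by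
  decide +kernel

theorem no_path_last : pathSearch 13 2 [1, 3, 4, 5, 6, 7, 8, 9, 10, 11, 12, 13, 14] = false := by
  decide +kernel

/-- The base vertex of which a vertex is a copy. -/
def proj {n : ℕ} (i : Fin n) : ℕ := min i.val 14

theorem proj_lt {n : ℕ} (i : Fin n) : proj i < 15 := by unfold proj; omega

/-- The graph on `n` vertices: vertex `14` of the base graph is blown up into a clique. -/
def bigGraph (n : ℕ) : SimpleGraph (Fin n) where
  Adj i j := i ≠ j ∧ baseAdj (proj i) (proj j) = true
  symm := ⟨fun i j h => ⟨h.1.symm, by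
    rw [baseAdj_symm _ _ (proj_lt _) (proj_lt _)]; exact h.2⟩⟩
  loopless := ⟨fun _ h => h.1 rfl⟩

theorem bigGraph_stronglyChordal (n : ℕ) : IsStronglyChordal (bigGraph n) := by
  refine stronglyChordal_of_gammaFree _ (fun i => baseRank (proj i))
    (fun i j => baseAdj (proj i) (proj j) = true) ?_ ?_
  · intro i j
    constructor
    · intro h
      by_cases hij : i = j
      · exact Or.inl hij
      · exact Or.inr ⟨hij, h⟩
    · rintro (rfl | h)
      · exact baseAdj_refl _ (proj_lt _)
      · exact h.2
  · intro i j k l h1 h2 h3 h4 h5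
    exact base_gammaFree _ _ _ _ (proj_lt _) (proj_lt _) (proj_lt _) (proj_lt _) h1 h2 h3 h4 h5

theorem bigGraph_succ {n : ℕ} (i j : Fin n) (h : j.val = i.val + 1) :
    (bigGraph n).Adj i j := by
  refine ⟨fun hij => by rw [hij] at h; omega, ?_⟩
  by_cases hi : i.val < 14
  · have h1 : proj i = i.val := by unfold proj; omega
    have h2 : proj j = i.val + 1 := by unfold proj; omega
    rw [h1, h2]
    exact baseAdj_succ _ hi
  · have h1 : proj i = 14 := by unfold proj; omega
    have h2 : proj j = 14 := by unfold proj; omega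
    rw [h1, h2]
    exact baseAdj_refl _ (by omega)

theorem bigGraph_hamiltonian (n : ℕ) (hn : 15 ≤ n) : (bigGraph n).IsHamiltonian := by
  have hle : cycleGraph n ≤ bigGraph n := by
    have aux : ∀ u v : Fin n, (u - v).val = 1 → (bigGraph n).Adj u v := by
      intro u v h
      rw [Fin.sub_def] at h
      simp only at h
      have hu := u.2
      have hv := v.2
      by_cases hc : v.val ≤ u.val
      · have : n - v.val + u.val = (u.val - v.val) + n := by omega
        rw [this, Nat.add_mod_right, Nat.mod_eq_of_lt (by omega)] at h
        exact (bigGraph_succ v u (by omega)).symm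
      · rw [Nat.mod_eq_of_lt (by omega)] at h
        have h1 : proj u = 0 := by unfold proj; omega
        have h2 : proj v = 14 := by unfold proj; omega
        refine ⟨fun e => hc (by rw [e]), ?_⟩
        rw [h1, h2]
        decide +kernel
    intro u v h
    rcases cycleGraph_adj'.1 h with h | h
    · exact aux _ _ h
    · exact (aux _ _ h).symm
  refine IsHamiltonian.mono hle ?_
  obtain ⟨m, rfl⟩ : ∃ m, n = m + 3 := ⟨n - 3, by omega⟩
  intro _
  refine ⟨0, cycleGraph.cycle m, ?_⟩
  rw [Walk.isHamiltonianCycle_iff_isCycle_and_length_eq]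
  exact ⟨cycleGraph.isCycle_cycle, by simp⟩

theorem exists_cycle_of_list {V : Type*} (G : SimpleGraph V) (l : List V) (hne : l ≠ [])
    (hl : l.IsChain G.Adj) (hnd : l.Nodup) (hlen : 3 ≤ l.length)
    (hlast : G.Adj (l.getLast hne) (l.head hne)) :
    ∃ (a : V) (c : G.Walk a a), c.IsCycle ∧ ∀ v, v ∈ c.support ↔ v ∈ l := by
  refine ⟨_, Walk.cons hlast (Walk.ofSupport l hne hl), ?_, ?_⟩
  · rw [Walk.isCycle_iff_isPath_tail_and_le_length]
    constructor
    · rw [Walk.isPath_def, Walk.support_tail_of_not_nil _ (by simp)]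
      simpa using hnd
    · rw [Walk.length_cons]
      have := Walk.length_support (Walk.ofSupport l hne hl)
      rw [Walk.support_ofSupport] at this
      omega
  · intro v
    rw [Walk.support_cons, Walk.support_ofSupport, List.mem_cons]
    constructor
    · rintro (rfl | h)
      · exact List.getLast_mem _
      · exact h
    · exact Or.inr

/-- A cycle through exactly the vertices `1, …, 13`. -/
theorem bigGraph_cycle (n : ℕ) (hn : 15 ≤ n) : ∃ (a : Fin n) (c : (bigGraph n).Walk a a),
    c.IsCycle ∧ ∀ v, v ∈ c.support ↔ 1 ≤ v.val ∧ v.val ≤ 13 := by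
  let l : List (Fin n) := [⟨9, by omega⟩, ⟨10, by omega⟩, ⟨11, by omega⟩, ⟨12, by omega⟩,
    ⟨13, by omega⟩, ⟨4, by omega⟩, ⟨5, by omega⟩, ⟨6, by omega⟩, ⟨7, by omega⟩, ⟨8, by omega⟩,
    ⟨3, by omega⟩, ⟨2, by omega⟩, ⟨1, by omega⟩]
  have hl : l.IsChain (bigGraph n).Adj := by
    simp only [l, List.isChain_cons_cons, List.isChain_singleton, and_true]
    refine ⟨?_, ?_, ?_, ?_, ?_, ?_, ?_, ?_, ?_, ?_, ?_, ?_⟩ <;>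
      exact ⟨by simp, by simp only [proj]; decide +kernel⟩
  have hne : l ≠ [] := by simp [l]
  have hlast : (bigGraph n).Adj (l.getLast hne) (l.head hne) := by
    have h : (bigGraph n).Adj ⟨1, by omega⟩ ⟨9, by omega⟩ :=
      ⟨by simp, by simp only [proj]; decide +kernel⟩
    exact h
  obtain ⟨a, c, hc, hs⟩ := exists_cycle_of_list _ l hne hl (by simp [l]) (by simp [l]) hlast
  refine ⟨a, c, hc, fun v => ?_⟩
  rw [hs]
  simp [l, Fin.ext_iff]
  omega

theorem bigGraph_not_extendible (n : ℕ) (hn : 15 ≤ n) : ¬ CycleExtendible (bigGraph n) := by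
  intro hE
  obtain ⟨a, c, hc, hcs⟩ := bigGraph_cycle n hn
  obtain ⟨b, c', hc', hss, hcard⟩ := hE a c hc (by
    intro h
    have : (⟨0, by omega⟩ : Fin n) ∈ c.support.toFinset := by rw [h]; simp
    rw [List.mem_toFinset, hcs] at this
    simp at this)
  obtain ⟨z, hz, hins⟩ : ∃ z, z ∉ c.support.toFinset ∧
      insert z c.support.toFinset = c'.support.toFinset := by
    obtain ⟨z, hz, hz'⟩ := Finset.exists_of_ssubset hss
    refine ⟨z, hz', Finset.eq_of_subset_of_card_le ?_ ?_⟩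
    · exact Finset.insert_subset hz hss.1
    · rw [Finset.card_insert_of_notMem hz', hcard]
  have hmem : ∀ v, v ∈ c'.support ↔ v = z ∨ (1 ≤ v.val ∧ v.val ≤ 13) := by
    intro v
    rw [← hcs, ← List.mem_toFinset, ← hins, Finset.mem_insert, List.mem_toFinset]
  rw [List.mem_toFinset, hcs] at hz
  have h2 : (⟨2, by omega⟩ : Fin n) ∈ c'.support := (hmem _).2 (Or.inr (by simp))
  set d := c'.rotate _ h2 with hd
  have hdc : d.IsCycle := by simpa [hd] using hc'
  have hdm : ∀ v, v ∈ d.support ↔ v = z ∨ (1 ≤ v.val ∧ v.val ≤ 13) := by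
    intro v
    rw [hd, Walk.mem_support_rotate_iff, hmem]
  clear_value d
  have hsup : d.support = ⟨2, by omega⟩ :: d.support.tail := d.cons_tail_support.symm
  have htne : d.support.tail ≠ [] := by
    intro h
    have h1 := d.length_support
    have h3 := hdc.three_le_length
    have h4 := congrArg List.length hsup
    rw [h, List.length_singleton] at h4
    omega
  have hlast : d.support.tail.getLast htne = ⟨2, by omega⟩ := by
    rw [List.getLast_tail]; simp
  obtain ⟨m, hm⟩ : ∃ m, d.support.tail = m ++ [(⟨2, Nat.lt_of_lt_of_le (by decide) hn⟩ : Fin n)] :=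
    ⟨d.support.tail.dropLast, by
      have h := List.dropLast_append_getLast htne
      rw [hlast] at h
      exact h.symm⟩
  have hnd : (m ++ [(⟨2, by omega⟩ : Fin n)]).Nodup := hm ▸ hdc.support_nodup
  have hmm : ∀ v, v ∈ m ↔ (v = z ∨ (1 ≤ v.val ∧ v.val ≤ 13)) ∧ v.val ≠ 2 := by
    intro v
    rw [← hdm, hsup, hm]
    rw [List.nodup_append] at hnd
    have := hnd.2.2
    simp only [List.mem_cons, List.mem_append, List.not_mem_nil, or_false]
    constructor
    · intro hv
      refine ⟨Or.inr (Or.inl hv), fun h => ?_⟩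
      exact this v hv ⟨2, by omega⟩ (by simp) (Fin.ext h)
    · rintro ⟨h | h | h, hne⟩
      · exact absurd (congrArg Fin.val h) hne
      · exact h
      · exact absurd (congrArg Fin.val h) hne
  have hpinj : ∀ x ∈ m, ∀ y ∈ m, proj x = proj y → x = y := by
    intro x hx y hy h
    rw [hmm] at hx hy
    unfold proj at h
    rcases hx.1 with rfl | hx' <;> rcases hy.1 with rfl | hy'
    · rfl
    · apply Fin.ext; omega
    · apply Fin.ext; omega
    · apply Fin.ext; omega
  have hmnd : (m.map proj).Nodup := by
    rw [List.nodup_map_iff_inj_on (List.nodup_append.1 hnd).1]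
    exact hpinj
  have hchain : List.IsChain (fun a b => baseAdj a b = true) (2 :: (m.map proj ++ [2])) := by
    have h := d.isChain_adj_support
    rw [hsup, hm] at h
    have h := (List.isChain_map (R := fun a b => baseAdj a b = true) (proj (n := n))).2
      (h.imp (fun _ _ hab => hab.2))
    simpa [proj] using h
  have hmap : ∀ w, w ∈ m.map proj ↔ (w = proj z ∨ (1 ≤ w ∧ w ≤ 13)) ∧ w ≠ 2 := by
    intro w
    rw [List.mem_map]
    constructor
    · rintro ⟨v, hv, rfl⟩
      rw [hmm] at hv
      rcases hv with ⟨rfl | h, h2⟩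
      · refine ⟨Or.inl rfl, ?_⟩
        unfold proj; omega
      · unfold proj
        omega
    · rintro ⟨rfl | h, h2⟩
      · refine ⟨z, (hmm _).2 ⟨Or.inl rfl, ?_⟩, rfl⟩
        unfold proj at h2; omega
      · refine ⟨⟨w, by omega⟩, (hmm _).2 ⟨Or.inr h, h2⟩, ?_⟩
        unfold proj; simp; omega
  have hpz : proj z = 0 ∨ proj z = 14 := by
    unfold proj; omega
  have fin : ∀ rem : List ℕ, rem.Nodup → rem.length = 13 → pathSearch 13 2 rem = false →
      (∀ w, w ∈ rem ↔ (w = proj z ∨ (1 ≤ w ∧ w ≤ 13)) ∧ w ≠ 2) → False := by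
    intro rem hrn hrl hrs hrm
    have hp : rem.Perm (m.map proj) := (List.perm_ext_iff_of_nodup hrn hmnd).2 (fun w => by
      rw [hrm, hmap])
    have := pathSearch_sound _ _ _ hp hchain
    rw [← hp.length_eq, hrl, hrs] at this
    exact absurd this (by simp)
  rcases hpz with h | h
  · refine fin _ (by decide) (by rfl) no_path_zero ?_
    intro w
    simp only [List.mem_cons, List.not_mem_nil, or_false, h]
    omega
  · refine fin _ (by decide) (by rfl) no_path_last ?_
    intro w
    simp only [List.mem_cons, List.not_mem_nil, or_false, h]
    omega

/-- stmt7 -/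
theorem stmt7 (n : ℕ) (hn : 15 ≤ n) :
    ∃ G : SimpleGraph (Fin n), IsStronglyChordal G ∧ G.IsHamiltonian ∧
      ¬ CycleExtendible G :=
  ⟨bigGraph n, bigGraph_stronglyChordal n, bigGraph_hamiltonian n hn,
    bigGraph_not_extendible n hn⟩
end

section
/- For every n ≥ 15, there exists a graph on n vertices that is chordal, Hamiltonian, P_9-free (contains no induced path on 9 vertices), and not cycle extendible. -/
namespace HendryP9

/-- Neighbourhoods (as bitmasks) of the 15-vertex base graph. -/
def nb (i : ℕ) : ℕ :=
  [18054, 5, 29851, 20, 5292, 4304, 160, 30581, 640, 1409, 31381, 5120, 11444, 21636,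
    9349].getD i 0

/-- Position in a perfect elimination ordering of the base graph. -/
def rk (i : ℕ) : ℕ := [7, 0, 10, 1, 4, 3, 2, 11, 5, 6, 12, 8, 9, 13, 14].getD i 0

/-- Equal or adjacent in the base graph. -/
def cl (a b : ℕ) : Bool := a == b || (nb a).testBit b

def adjB (a b : ℕ) : Bool := a != b && cl (min a 14) (min b 14)

theorem cl_symm_aux : ∀ a : Fin 15, ∀ b : Fin 15, cl a b = cl b a := by decide +kernel

theorem cl_symm (a b : ℕ) (ha : a < 15) (hb : b < 15) : cl a b = cl b a :=
  cl_symm_aux ⟨a, ha⟩ ⟨b, hb⟩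

theorem peo_aux : ∀ a : Fin 15, ∀ b : Fin 15, ∀ c : Fin 15, cl a b = true → cl a c = true →
    rk a ≤ rk b → rk a ≤ rk c → cl b c = true := by decide +kernel

theorem min_lt (a : ℕ) : min a 14 < 15 := by omega

/-- The base graph with vertex 14 blown up to a clique of true twins. -/
def GG (n : ℕ) : SimpleGraph (Fin n) where
  Adj a b := adjB a.val b.val = true
  symm := ⟨by
    intro a b h
    simp only [adjB, Bool.and_eq_true, bne_iff_ne] at h ⊢
    exact ⟨fun e => h.1 e.symm, by rw [cl_symm _ _ (min_lt _) (min_lt _)]; exact h.2⟩⟩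
  loopless := ⟨by intro a; simp [adjB]⟩

theorem GG_adj {n : ℕ} {a b : Fin n} :
    (GG n).Adj a b ↔ a ≠ b ∧ cl (min a.val 14) (min b.val 14) = true := by
  show adjB a.val b.val = true ↔ _
  simp [adjB, Fin.ext_iff]

theorem chordal (n : ℕ) : IsChordal (GG n) := by
  intro m hm
  refine ⟨fun φ => ?_⟩
  obtain ⟨k, rfl⟩ : ∃ k, m = k + 4 := ⟨m - 4, by omega⟩
  obtain ⟨i, -, hi⟩ := Finset.exists_min_image (Finset.univ : Finset (Fin (k + 4)))
    (fun i => rk (min (φ i).val 14)) ⟨0, Finset.mem_univ _⟩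
  have h1 : (SimpleGraph.cycleGraph (k + 4)).Adj i (i + 1) := by
    rw [SimpleGraph.cycleGraph_adj]; right; abel
  have h2 : (SimpleGraph.cycleGraph (k + 4)).Adj i (i - 1) := by
    rw [SimpleGraph.cycleGraph_adj]; left; abel
  have two : (1 + 1 : Fin (k + 4)) ≠ 1 := by
    intro h
    simp at h
  have v2 : ((1 + 1 : Fin (k + 4)) : ℕ) = 2 := by
    rw [Fin.val_add]; simp
  have two0 : (1 + 1 : Fin (k + 4)) ≠ 0 := by
    intro h
    have := congrArg Fin.val h
    rw [v2] at this; simp at this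
  have three : (1 + 1 + 1 : Fin (k + 4)) ≠ 0 := by
    intro h
    have := congrArg Fin.val h
    rw [Fin.val_add, v2] at this; simp at this
    rw [Nat.mod_eq_of_lt (by omega)] at this; omega
  have h3 : ¬ (SimpleGraph.cycleGraph (k + 4)).Adj (i + 1) (i - 1) := by
    rw [SimpleGraph.cycleGraph_adj]
    rintro (h | h)
    · apply two
      exact Eq.trans (by abel) h
    · apply three; nth_rewrite 3 [← h]; abel
  have h4 : i + 1 ≠ i - 1 := by
    intro h
    apply two0
    calc (1 + 1 : Fin (k + 4)) = (i + 1) - (i - 1) := by abel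
      _ = 0 := by rw [h]; abel
  rw [← φ.map_adj_iff] at h1 h2 h3
  rw [GG_adj] at h1 h2 h3
  apply h3
  refine ⟨fun h => h4 (φ.injective h), ?_⟩
  exact peo_aux ⟨_, min_lt _⟩ ⟨_, min_lt _⟩ ⟨_, min_lt _⟩ h1.2 h2.2
    (hi _ (Finset.mem_univ _)) (hi _ (Finset.mem_univ _))

theorem succ_aux : ∀ a : Fin 14, cl a (a + 1) = true := by decide +kernel

theorem cyc_le (k : ℕ) : SimpleGraph.cycleGraph (k + 15) ≤ GG (k + 15) := by
  have key : ∀ u v : Fin (k + 15), u - v = 1 → (GG (k + 15)).Adj v u := by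
    intro u v h
    have hu : u = v + 1 := by rw [← h]; abel
    subst hu
    rw [GG_adj]
    refine ⟨by simp, ?_⟩
    by_cases hv : v = Fin.last (k + 14)
    · subst hv
      simp
      decide
    · rw [Fin.val_add_one, if_neg hv]
      by_cases h14 : v.val < 14
      · have := succ_aux ⟨v.val, h14⟩
        rw [min_eq_left (by omega), min_eq_left (by omega)]
        exact this
      · rw [min_eq_right (by omega), min_eq_right (by omega)]
        decide
  intro u v h
  rw [SimpleGraph.cycleGraph_adj] at h
  rcases h with h | h
  · exact (key _ _ h).symm
  · exact key _ _ h

theorem ham (k : ℕ) : (GG (k + 15)).IsHamiltonian := by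
  apply SimpleGraph.IsHamiltonian.mono (cyc_le k)
  intro _
  refine ⟨0, SimpleGraph.cycleGraph.cycle (k + 12), ?_⟩
  rw [SimpleGraph.Walk.isHamiltonianCycle_iff_isCycle_and_length_eq]
  refine ⟨SimpleGraph.cycleGraph.isCycle_cycle, ?_⟩
  rw [SimpleGraph.cycleGraph.length_cycle]; simp

/-! Induced paths -/

def ok (v : ℕ) : List ℕ → Bool
  | [] => true
  | q :: r => q != v && cl q v && r.all (fun x => !cl x v)

def paths : ℕ → List (List ℕ)
  | 0 => [[]]
  | k + 1 => (paths k).flatMap fun p => ((List.range 15).filter fun v => ok v p).map (· :: p)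

theorem paths_nine : paths 9 = [] := by decide +kernel

/-- `[g (k-1), …, g 0]`. -/
def rl (g : ℕ → ℕ) : ℕ → List ℕ
  | 0 => []
  | k + 1 => g k :: rl g k

theorem mem_rl (g : ℕ → ℕ) (k x : ℕ) (h : x ∈ rl g k) : ∃ i < k, g i = x := by
  induction k with
  | zero => simp [rl] at h
  | succ k ih =>
    simp only [rl, List.mem_cons] at h
    rcases h with h | h
    · exact ⟨k, by omega, h.symm⟩
    · obtain ⟨i, hi, e⟩ := ih h
      exact ⟨i, by omega, e⟩

theorem rl_mem (g : ℕ → ℕ) (h15 : ∀ i < 9, g i < 15)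
    (hne : ∀ i j, i < j → j < 9 → g i ≠ g j)
    (hadj : ∀ i j, i < j → j < 9 → (cl (g i) (g j) = true ↔ i + 1 = j)) (k : ℕ) (hk : k ≤ 9) :
    rl g k ∈ paths k := by
  induction k with
  | zero => simp [rl, paths]
  | succ k ih =>
    simp only [rl, paths, List.mem_flatMap, List.mem_map, List.mem_filter, List.mem_range]
    refine ⟨rl g k, ih (by omega), g k, ⟨h15 k (by omega), ?_⟩, rfl⟩
    cases k with
    | zero => rfl
    | succ j =>
      simp only [rl, ok, Bool.and_eq_true, bne_iff_ne, List.all_eq_true, Bool.not_eq_true']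
      refine ⟨⟨hne _ _ (by omega) (by omega), (hadj _ _ (by omega) (by omega)).2 rfl⟩, ?_⟩
      intro x hx
      obtain ⟨i, hi, rfl⟩ := mem_rl g j x hx
      rw [Bool.eq_false_iff]
      intro h
      have := (hadj i (j + 1) (by omega) (by omega)).1 h
      omega

theorem p9free (n : ℕ) : IsEmpty (SimpleGraph.pathGraph 9 ↪g GG n) := by
  refine ⟨fun φ => ?_⟩
  have hA : ∀ i j : Fin 9, i ≠ j → (cl (min (φ i).val 14) (min (φ j).val 14) = true ↔
      (i.val + 1 = j.val ∨ j.val + 1 = i.val)) := by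
    intro i j hij
    have h := φ.map_adj_iff (v := i) (w := j)
    rw [GG_adj, SimpleGraph.pathGraph_adj] at h
    rw [← h]
    exact ⟨fun h' => ⟨fun e => hij (φ.injective e), h'⟩, fun h' => h'.2⟩
  have tw : ∀ i j : Fin 9, i < j → i.val + 1 = j.val → ∃ k : Fin 9, k ≠ i ∧ k ≠ j ∧
      ¬ ((i.val + 1 = k.val ∨ k.val + 1 = i.val) ↔ (j.val + 1 = k.val ∨ k.val + 1 = j.val)) := by
    decide
  have hN : ∀ i j : Fin 9, i < j → min (φ i).val 14 ≠ min (φ j).val 14 := by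
    intro i j hij e
    have h1 := (hA i j hij.ne).1 (by rw [e]; simp [cl])
    have h2 : i.val + 1 = j.val := by
      have : i.val < j.val := hij
      omega
    obtain ⟨k, hk1, hk2, hk⟩ := tw i j hij h2
    apply hk
    rw [← hA i k hk1.symm, ← hA j k hk2.symm, e]
  let g : ℕ → ℕ := fun i => if h : i < 9 then min (φ ⟨i, h⟩).val 14 else 0
  have hg : ∀ i (h : i < 9), g i = min (φ ⟨i, h⟩).val 14 := fun i h => by simp [g, h]
  have := rl_mem g (fun i h => by rw [hg i h]; omega)
    (fun i j hij hj => by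
      rw [hg i (by omega), hg j hj]
      exact hN _ _ hij)
    (fun i j hij hj => by
      rw [hg i (by omega), hg j hj, hA _ _ (by simp [Fin.ext_iff]; omega)]
      simp; omega) 9 le_rfl
  rw [paths_nine] at this
  simp at this

/-! Non-extendability -/

/-- The base vertices of degree two. -/
def deg2 : List ℕ := [1, 3, 6, 8, 11]

theorem deg2_aux : ∀ d ∈ deg2, d ≠ 7 ∧ d < 14 ∧ ∀ x : Fin 15, ∀ y : Fin 15, ∀ c : Fin 15,
    cl d x = true → cl d y = true → cl d c = true →
    x = y ∨ x = c ∨ y = c ∨ x.val = d ∨ y.val = d ∨ c.val = d := by decide +kernel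

/-- Search for a path with `k` edges from `c` to `7` avoiding `vis`, which has to visit
the vertices of degree two. -/
def search : ℕ → ℕ → ℕ → Bool
  | 0, c, _ => c == 7
  | k + 1, c, vis => c != 7 && (List.range 15).any fun v =>
      cl c v && !(vis ||| 1 <<< c).testBit v &&
      deg2.all (fun d => d == v || !cl c d || (vis ||| 1 <<< c).testBit d) &&
      search k v (vis ||| 1 <<< c)

theorem search13 : ∀ v : Fin 15, (v.val == 7 || v.val == 13 || !cl 7 v || !search 13 v (1 <<< 13)) = true := by
  decide +kernel

theorem search14 : ∀ v : Fin 15, (v.val == 7 || v.val == 14 || !cl 7 v || !search 13 v (1 <<< 14)) = true := by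
  decide +kernel

theorem interior {V : Type*} {G : SimpleGraph V} {u w : V} (p : G.Walk u w) (hp : p.IsPath)
    (d : V) (hd : d ∈ p.support) (hu : d ≠ u) (hw : d ≠ w) :
    ∃ a ∈ p.support, ∃ b ∈ p.support, a ≠ b ∧ G.Adj d a ∧ G.Adj d b := by
  induction p with
  | nil => simp at hd; exact absurd hd hu
  | @cons u v w h p ih =>
    rw [SimpleGraph.Walk.cons_isPath_iff] at hp
    have hd' : d ∈ p.support := by simpa [hu] using hd
    by_cases hv : d = v
    · subst hv
      cases p with
      | nil => exact absurd rfl hw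
      | @cons _ y _ h' q =>
        refine ⟨u, by simp, y, by simp, ?_, h.symm, h'⟩
        rintro rfl
        exact hp.2 (by simp)
    · obtain ⟨a, ha, b, hb, hh⟩ := ih hp.1 hd' hv hw
      exact ⟨a, by simp [ha], b, by simp [hb], hh⟩

theorem sound {n : ℕ} {u w : Fin n} (p : (GG n).Walk u w) (hw : w.val = 7) (hp : p.IsPath)
    (inj : ∀ a ∈ p.support, ∀ b ∈ p.support, min a.val 14 = min b.val 14 → a = b) (vis : ℕ)
    (hv : ∀ a ∈ p.support, vis.testBit (min a.val 14) = false)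
    (hf : ∀ d < 15, vis.testBit d = false → ∃ a ∈ p.support, min a.val 14 = d) :
    search p.length (min u.val 14) vis = true := by
  induction p generalizing vis with
  | nil => simp [search, hw]
  | @cons u v w h p ih =>
    rw [SimpleGraph.Walk.cons_isPath_iff] at hp
    have hvis : ∀ a ∈ p.support, (vis ||| 1 <<< (min u.val 14)).testBit (min a.val 14) = false := by
      intro a ha
      have hne : min u.val 14 ≠ min a.val 14 := by
        intro e
        have := inj u (by simp) a (by simp [ha]) e
        exact hp.2 (this ▸ ha)
      rw [Nat.testBit_or, hv a (by simp [ha]), Nat.one_shiftLeft, Nat.testBit_two_pow]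
      simp only [Bool.false_or, decide_eq_false_iff_not]
      exact hne
    have hfull : ∀ d < 15, (vis ||| 1 <<< (min u.val 14)).testBit d = false →
        ∃ a ∈ p.support, min a.val 14 = d := by
      intro d hd hb
      rw [Nat.testBit_or, Nat.one_shiftLeft, Nat.testBit_two_pow, Bool.or_eq_false_iff] at hb
      obtain ⟨a, ha, e⟩ := hf d hd hb.1
      rw [SimpleGraph.Walk.support_cons, List.mem_cons] at ha
      rcases ha with rfl | ha
      · simp [e] at hb
      · exact ⟨a, ha, e⟩
    have ih' := ih hw hp.1 (fun a ha b hb => inj a (by simp [ha]) b (by simp [hb])) _ hvis hfull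
    simp only [SimpleGraph.Walk.length_cons, search, Bool.and_eq_true, bne_iff_ne,
      List.any_eq_true, List.mem_range]
    refine ⟨?_, min v.val 14, by omega, ⟨⟨(GG_adj.1 h).2, ?_⟩, ?_⟩, ih'⟩
    · intro h7
      have : u = w := by ext; omega
      exact hp.2 (this ▸ p.end_mem_support)
    · rw [hvis v (by simp)]; rfl
    · rw [List.all_eq_true]
      intro d hd
      by_contra hcon
      simp only [Bool.or_eq_true, not_or, Bool.not_eq_true, Bool.not_eq_false',
        beq_eq_false_iff_ne] at hcon
      obtain ⟨⟨hdv, hcd⟩, hb⟩ := hcon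
      obtain ⟨hd7, hd14, hD⟩ := deg2_aux d hd
      obtain ⟨a, ha, rfl⟩ := hfull d (by omega) hb
      have hau : a ≠ u := fun e => hp.2 (e ▸ ha)
      obtain ⟨x, hx, y, hy, hxy, hax, hay⟩ := interior p hp.1 a ha
        (fun e => hdv (by rw [e])) (fun e => hd7 (by rw [e]; omega))
      have I : ∀ s ∈ (SimpleGraph.Walk.cons h p).support,
          ∀ t ∈ (SimpleGraph.Walk.cons h p).support, s ≠ t → min s.val 14 ≠ min t.val 14 :=
        fun s hs t ht hst e => hst (inj s hs t ht e)
      have hxu : x ≠ u := fun e => hp.2 (e ▸ hx)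
      have hyu : y ≠ u := fun e => hp.2 (e ▸ hy)
      have hx' : x ∈ (SimpleGraph.Walk.cons h p).support := by simp [hx]
      have hy' : y ∈ (SimpleGraph.Walk.cons h p).support := by simp [hy]
      have ha' : a ∈ (SimpleGraph.Walk.cons h p).support := by simp [ha]
      have hu' : u ∈ (SimpleGraph.Walk.cons h p).support := by simp
      have := hD ⟨_, min_lt x.val⟩ ⟨_, min_lt y.val⟩ ⟨_, min_lt u.val⟩ (GG_adj.1 hax).2
        (GG_adj.1 hay).2 (by rw [cl_symm _ _ (min_lt _) (min_lt _)]; exact hcd)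
      simp only [Fin.mk.injEq] at this
      rcases this with h | h | h | h | h | h
      · exact I _ hx' _ hy' hxy h
      · exact I _ hx' _ hu' hxu h
      · exact I _ hy' _ hu' hyu h
      · exact I _ hx' _ ha' hax.ne.symm h
      · exact I _ hy' _ ha' hay.ne.symm h
      · exact I _ hu' _ ha' hau.symm h

theorem adj_mk {n a b : ℕ} (ha : a < n) (hb : b < n) (h : adjB a b = true) :
    (GG n).Adj ⟨a, ha⟩ ⟨b, hb⟩ := h

theorem exists_cycle (n : ℕ) (hn : 15 ≤ n) : ∃ (a : Fin n) (c : (GG n).Walk a a), c.IsCycle ∧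
    ∀ v : Fin n, v ∈ c.support ↔ v.val < 13 := by
  have L : ∀ a, a < 15 → a < n := fun a h => by omega
  refine ⟨⟨4, L 4 (by decide)⟩,
    .cons (adj_mk (b := 3) _ (L _ (by decide)) (by decide)) <|
    .cons (adj_mk (b := 2) _ (L _ (by decide)) (by decide)) <|
    .cons (adj_mk (b := 1) _ (L _ (by decide)) (by decide)) <|
    .cons (adj_mk (b := 0) _ (L _ (by decide)) (by decide)) <|
    .cons (adj_mk (b := 9) _ (L _ (by decide)) (by decide)) <|
    .cons (adj_mk (b := 8) _ (L _ (by decide)) (by decide)) <|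
    .cons (adj_mk (b := 7) _ (L _ (by decide)) (by decide)) <|
    .cons (adj_mk (b := 6) _ (L _ (by decide)) (by decide)) <|
    .cons (adj_mk (b := 5) _ (L _ (by decide)) (by decide)) <|
    .cons (adj_mk (b := 12) _ (L _ (by decide)) (by decide)) <|
    .cons (adj_mk (b := 11) _ (L _ (by decide)) (by decide)) <|
    .cons (adj_mk (b := 10) _ (L _ (by decide)) (by decide)) <|
    .cons (adj_mk (b := 4) _ (L _ (by decide)) (by decide)) .nil, ?_, ?_⟩
  · simp [SimpleGraph.Walk.cons_isCycle_iff, SimpleGraph.Walk.cons_isPath_iff]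
  · intro v
    simp [Fin.ext_iff]
    omega

theorem not_ext (n : ℕ) (hn : 15 ≤ n) : ¬ CycleExtendible (GG n) := by
  intro H
  obtain ⟨a, c, hc, hs⟩ := exists_cycle n hn
  have hcard : c.support.toFinset.card = 13 := by
    have : c.support.toFinset = (Finset.univ : Finset (Fin 13)).map
        (Fin.castLEEmb (by omega : 13 ≤ n)) := by
      ext v
      simp only [List.mem_toFinset, hs, Finset.mem_map, Finset.mem_univ, true_and]
      constructor
      · intro h; exact ⟨⟨v.val, h⟩, by ext; simp⟩
      · rintro ⟨i, rfl⟩; simp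
    rw [this]; simp
  obtain ⟨b, c', hc', hsub, hcard'⟩ := H a c hc (by
    intro h
    have : (⟨13, by omega⟩ : Fin n) ∈ c.support.toFinset := by rw [h]; simp
    rw [List.mem_toFinset, hs] at this
    simp at this)
  obtain ⟨x, hx, hx'⟩ := Finset.exists_of_ssubset hsub
  have hins : insert x c.support.toFinset = c'.support.toFinset := by
    apply Finset.eq_of_subset_of_card_le
    · exact Finset.insert_subset hx hsub.1
    · rw [Finset.card_insert_of_notMem hx', hcard']
  have hmem : ∀ v, v ∈ c'.support ↔ v = x ∨ v.val < 13 := by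
    intro v
    rw [← List.mem_toFinset, ← hins, Finset.mem_insert, List.mem_toFinset, hs]
  have hx13 : 13 ≤ x.val := by
    rw [List.mem_toFinset, hs] at hx'; omega
  have h7 : (⟨7, by omega⟩ : Fin n) ∈ c'.support := by rw [hmem]; right; simp
  have hd := hc'.rotate h7
  have hdm : ∀ v, v ∈ (c'.rotate _ h7).support ↔ v = x ∨ v.val < 13 := by
    intro v
    rw [← hmem, SimpleGraph.Walk.mem_support_rotate_iff]
  have hdc : (c'.rotate _ h7).support.toFinset.card = 14 := by
    have e : (c'.rotate _ h7).support.toFinset = c'.support.toFinset := by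
      ext v
      rw [List.mem_toFinset, List.mem_toFinset, hdm, hmem]
    rw [e, hcard', hcard]
  generalize c'.rotate _ h7 = d at hd hdm hdc
  cases d with
  | nil => simp at hd
  | @cons _ v _ h p =>
    rw [SimpleGraph.Walk.cons_isCycle_iff] at hd
    have hpm : ∀ v ∈ p.support, v = x ∨ v.val < 13 := fun v hv => (hdm v).1 (by simp [hv])
    have hlen : p.length = 13 := by
      have e : (SimpleGraph.Walk.cons h p).support.toFinset = p.support.toFinset := by
        simp
      rw [e, List.toFinset_card_of_nodup hd.1.support_nodup,
        SimpleGraph.Walk.length_support] at hdc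
      omega
    have hinj : ∀ a ∈ p.support, ∀ b ∈ p.support, min a.val 14 = min b.val 14 → a = b := by
      intro a ha b hb e
      rcases hpm a ha with rfl | ha <;> rcases hpm b hb with rfl | hb
      · rfl
      all_goals (ext; omega)
    obtain ⟨hne, hcl⟩ := GG_adj.1 h
    have hv7 : min v.val 14 ≠ 7 := by
      intro e
      apply hne; ext; simp; omega
    have hpm' : ∀ v : Fin n, (v = x ∨ v.val < 13) → v ∈ p.support := by
      intro v hv
      have := (hdm v).2 hv
      rw [SimpleGraph.Walk.support_cons, List.mem_cons] at this
      rcases this with rfl | h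
      · exact p.end_mem_support
      · exact h
    have fin : ∀ m, (∀ a ∈ p.support, m ≠ min a.val 14) →
        (∀ d < 15, d ≠ m → d = min x.val 14 ∨ d < 13) →
        (∀ v : Fin 15, (v.val == 7 || v.val == m || !cl 7 v || !search 13 v (1 <<< m)) = true) → False := by
      intro m hm hm' hS
      have h1 := sound p rfl hd.1 hinj (1 <<< m) (by
        intro a ha
        rw [Nat.one_shiftLeft, Nat.testBit_two_pow]
        simpa using hm a ha) (by
        intro d hd hb
        rw [Nat.one_shiftLeft, Nat.testBit_two_pow] at hb
        rcases hm' d hd (by rintro rfl; simp at hb) with h | h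
        · exact ⟨x, hpm' x (Or.inl rfl), h.symm⟩
        · exact ⟨⟨d, by omega⟩, hpm' _ (Or.inr h), by simp; omega⟩)
      rw [hlen] at h1
      have hmv := hm v (by simp)
      have h2 := hS ⟨min v.val 14, min_lt _⟩
      simp only [h1] at h2
      simp at hcl
      simp [hcl] at h2
      omega
    by_cases hx14 : x.val = 13
    · refine fin 14 ?_ (by omega) search14
      intro a ha
      rcases hpm a ha with rfl | ha <;> omega
    · refine fin 13 ?_ (by omega) search13
      intro a ha
      rcases hpm a ha with rfl | ha <;> omega

end HendryP9

/-- stmt8: a `P_9`-free counterexample to Hendry's conjecture on `n` vertices for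
every `n ≥ 15`. -/
theorem stmt8 (n : ℕ) (hn : 15 ≤ n) :
    ∃ G : SimpleGraph (Fin n), IsChordal G ∧ G.IsHamiltonian ∧
      IsEmpty (SimpleGraph.pathGraph 9 ↪g G) ∧ ¬ CycleExtendible G := by
  refine ⟨HendryP9.GG n, HendryP9.chordal n, ?_, HendryP9.p9free n, HendryP9.not_ext n hn⟩
  obtain ⟨k, rfl⟩ : ∃ k, n = k + 15 := ⟨n - 15, by omega⟩
  exact HendryP9.ham k
end

section
/- For every k ≥ 2, there exists a chordal Hamiltonian graph with (vertex) connectivity exactly k that is not cycle extendible. -/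
/-- `S` is a cutset of `G` : removing `S` disconnects `G` or reduces it to a single
vertex. -/
def IsCutSet {V : Type*} (G : SimpleGraph V) (S : Finset V) : Prop :=
  ¬ (G.induce ((↑S : Set V)ᶜ)).Connected ∨ ((↑S : Set V)ᶜ).ncard ≤ 1

/-- `G` has (vertex) connectivity exactly `k` : some `k`-set is a cutset and no
smaller set is. -/
def HasConnectivity {V : Type*} (G : SimpleGraph V) (k : ℕ) : Prop :=
  (∃ S : Finset V, S.card = k ∧ IsCutSet G S) ∧ ∀ S : Finset V, IsCutSet G S → k ≤ S.card

/-! The base graph on 18 vertices, given by adjacency bitmasks. -/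

/-- adjacency rows of the base graph -/
def hRow : ℕ → ℕ := fun i =>
  [4096, 8192, 320, 49152, 196608, 640, 33540, 66336, 115396, 116192, 117248, 246784,
    106497, 249858, 241416, 229192, 196496, 124944].getD i 0

/-- adjacency of the base graph -/
def hAdj (i j : ℕ) : Bool := (hRow i).testBit j

theorem hAdj_symm : ∀ i < 18, ∀ j < 18, hAdj i j = true → hAdj j i = true := by
  decide +kernel

theorem hAdj_peo_fin : ∀ i j l : Fin 18, (i.val < j.val ∧ i.val < l.val ∧ j.val ≠ l.val ∧
    hAdj i j = true ∧ hAdj i l = true) → hAdj j l = true := by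
  decide +kernel

theorem hAdj_peo : ∀ i < 18, ∀ j < 18, ∀ l < 18, (i < j ∧ i < l ∧ j ≠ l ∧
    hAdj i j = true ∧ hAdj i l = true) → hAdj j l = true :=
  fun i hi j hj l hl h => hAdj_peo_fin ⟨i, hi⟩ ⟨j, hj⟩ ⟨l, hl⟩ h

/-- Search for a Hamiltonian path, with pruning by the number of vertices having at most
one available neighbour. -/
def hSearch : ℕ → List ℕ → ℕ → Bool
  | 0, rem, _ => rem.isEmpty
  | f + 1, rem, cur =>
    rem.isEmpty ||
      (Nat.ble (rem.countP (fun y => Nat.ble ((cur :: rem).countP (hAdj y)) 1)) 1 &&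
        rem.any (fun x => hAdj cur x && hSearch f (rem.erase x) x))

theorem few_le (M : List ℕ) : ∀ (l pre : List ℕ) (cur : ℕ), M = pre ++ cur :: l →
    (cur :: l).IsChain (fun a b => hAdj a b = true ∧ hAdj b a = true) →
    l.countP (fun y => Nat.ble (M.countP (hAdj y)) 1) ≤ 1
  | [], _, _, _, _ => by simp
  | [x], _, _, _, _ => by
      rw [List.countP_cons, List.countP_nil]; split_ifs <;> omega
  | x :: z :: t, pre, cur, hM, hc => by
      have ih := few_le M (z :: t) (pre ++ [cur]) x (by simp [hM]) hc.tail
      rw [List.countP_cons]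
      have h1 : hAdj x cur = true := by
        have := hc; simp at this; exact this.1.2
      have h2 : hAdj x z = true := by
        have := hc; simp at this; exact this.2.1.1
      have h3 : 2 ≤ M.countP (hAdj x) := by
        rw [hM]
        simp only [List.countP_append, List.countP_cons, h1, h2, if_true]
        omega
      have h4 : Nat.ble (M.countP (hAdj x)) 1 = false := by
        rw [← Bool.not_eq_true, Nat.ble_eq]; omega
      simp only [h4]
      simpa using ih

theorem hSearch_complete : ∀ (f : ℕ) (l rem : List ℕ) (cur : ℕ), l.Perm rem → l.length ≤ f →
    (cur :: l).IsChain (fun a b => hAdj a b = true ∧ hAdj b a = true) →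
    hSearch f rem cur = true
  | 0, l, rem, cur, hp, hf, _ => by
      have : l = [] := List.length_eq_zero_iff.1 (by omega)
      subst this
      have := hp.symm.eq_nil
      subst this
      rfl
  | f + 1, [], rem, cur, hp, _, _ => by
      have := hp.symm.eq_nil
      subst this
      simp [hSearch]
  | f + 1, x :: t, rem, cur, hp, hf, hc => by
      have hx : x ∈ rem := hp.subset (by simp)
      have hfew := few_le (cur :: x :: t) (x :: t) [] cur rfl hc
      have hcount : ∀ y, (cur :: x :: t).countP (hAdj y) = (cur :: rem).countP (hAdj y) :=
        fun y => (hp.cons cur).countP_eq _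
      have ih := hSearch_complete f t (rem.erase x) x (by
        have := hp.erase x
        simpa using this) (by simpa using hf) hc.tail
      have h1 : hAdj cur x = true := by
        have := hc; simp at this; exact this.1.1
      simp only [hcount] at hfew
      rw [hp.countP_eq] at hfew
      rw [hSearch, Bool.or_eq_true, Bool.and_eq_true]
      right
      refine ⟨?_, ?_⟩
      · rw [Nat.ble_eq]; exact hfew
      · rw [List.any_eq_true]
        exact ⟨x, hx, by simp [h1, ih]⟩

theorem no_path_10 : ((List.range 18).erase 10).all
    (fun x => !hSearch 17 (((List.range 18).erase 10).erase x) x) = true := by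
  decide +kernel

theorem no_path_11 : ((List.range 18).erase 11).all
    (fun x => !hSearch 17 (((List.range 18).erase 11).erase x) x) = true := by
  decide +kernel

theorem no_path (v : ℕ) (hv : v = 10 ∨ v = 11) (l : List ℕ)
    (hp : l.Perm ((List.range 18).erase v))
    (hc : l.IsChain (fun a b => hAdj a b = true ∧ hAdj b a = true)) : False := by
  have key : ((List.range 18).erase v).all
    (fun x => !hSearch 17 (((List.range 18).erase v).erase x) x) = true := by
    rcases hv with rfl | rfl
    · exact no_path_10
    · exact no_path_11
  have hlen : l.length = 17 := by
    rw [hp.length_eq]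
    rcases hv with rfl | rfl <;> rfl
  cases l with
  | nil => simp at hlen
  | cons x t =>
    rw [List.all_eq_true] at key
    have h := key x (hp.subset (by simp))
    have h2 := hSearch_complete 17 t (((List.range 18).erase v).erase x) x (by
      have := hp.erase x
      simpa using this) (by simp at hlen; omega) hc
    simp [h2] at h

/-- The graph: base graph (values below 18), `k` universal vertices, `k - 1` vertices
adjacent to the universal vertices only. -/
def bigG (k : ℕ) : SimpleGraph (Fin (17 + 2 * k)) where
  Adj a b := a ≠ b ∧ ((18 ≤ a.val ∧ a.val < 18 + k) ∨ (18 ≤ b.val ∧ b.val < 18 + k) ∨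
    (a.val < 18 ∧ b.val < 18 ∧ hAdj a.val b.val = true))
  symm := ⟨by
    rintro a b ⟨h, h1 | h1 | h1⟩
    · exact ⟨h.symm, Or.inr (Or.inl h1)⟩
    · exact ⟨h.symm, Or.inl h1⟩
    · exact ⟨h.symm, Or.inr (Or.inr ⟨h1.2.1, h1.1, hAdj_symm _ h1.1 _ h1.2.1 h1.2.2⟩)⟩⟩
  loopless := ⟨by rintro a ⟨h, _⟩; exact h rfl⟩

theorem bigG_adj (k : ℕ) (a b : Fin (17 + 2 * k)) : (bigG k).Adj a b ↔
    a ≠ b ∧ ((18 ≤ a.val ∧ a.val < 18 + k) ∨ (18 ≤ b.val ∧ b.val < 18 + k) ∨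
    (a.val < 18 ∧ b.val < 18 ∧ hAdj a.val b.val = true)) := Iff.rfl

theorem bigG_chordal (k : ℕ) : IsChordal (bigG k) := by
  intro n hn
  refine ⟨fun f => ?_⟩
  obtain ⟨n, rfl⟩ : ∃ m, n = m + 4 := ⟨n - 4, by omega⟩
  have adjS : ∀ x : Fin (n + 4), (SimpleGraph.cycleGraph (n + 4)).Adj x (x + 1) := by
    intro x
    rw [SimpleGraph.cycleGraph_adj]; right; simp
  have adjP : ∀ x : Fin (n + 4), (SimpleGraph.cycleGraph (n + 4)).Adj x (x - 1) := by
    intro x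
    rw [SimpleGraph.cycleGraph_adj]; left; simp
  have two_ne : ∀ x : Fin (n + 4), x + 1 ≠ x - 1 := by
    intro x h
    have h2 : (1 : Fin (n + 4)) + 1 = 0 := by
      have : (x + 1) - (x - 1) = 0 := sub_eq_zero.2 h
      rw [← this]; abel
    have := congrArg Fin.val h2
    simp [Fin.val_add] at this
    rw [Nat.mod_eq_of_lt (by omega)] at this
    omega
  have nadj : ∀ x : Fin (n + 4), ¬ (SimpleGraph.cycleGraph (n + 4)).Adj (x + 1) (x - 1) := by
    intro x h
    rw [SimpleGraph.cycleGraph_adj] at h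
    rcases h with h | h
    · have h2 : (1 : Fin (n + 4)) = 0 := by
        have : (x + 1) - (x - 1) - 1 = 0 := by rw [h]; simp
        rw [← this]; abel
      have := congrArg Fin.val h2
      simp at this
    · have h2 : (1 : Fin (n + 4)) + 1 + 1 = 0 := by
        have : 1 - ((x - 1) - (x + 1)) = 0 := by rw [h]; simp
        rw [← this]; abel
      have := congrArg Fin.val h2
      simp [Fin.val_add] at this
      rw [Nat.mod_eq_of_lt (by omega)] at this
      omega
  have noU : ∀ x, ¬ (18 ≤ (f x).val ∧ (f x).val < 18 + k) := by
    intro x hx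
    have h1 := nadj (x + 1)
    have h2 := two_ne (x + 1)
    rw [add_sub_cancel_right] at h1 h2
    apply h1
    rw [← f.map_adj_iff, bigG_adj]
    exact ⟨fun h => h2 (f.injective h), Or.inr (Or.inl hx)⟩
  have base : ∀ x, (f x).val < 18 := by
    intro x
    have h := (f.map_adj_iff).2 (adjS x)
    rw [bigG_adj] at h
    rcases h.2 with h | h | h
    · exact absurd h (noU _)
    · exact absurd h (noU _)
    · exact h.1
  have base2 : ∀ x y, (SimpleGraph.cycleGraph (n + 4)).Adj x y →
      hAdj (f x).val (f y).val = true := by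
    intro x y h
    have h := (f.map_adj_iff).2 h
    rw [bigG_adj] at h
    rcases h.2 with h | h | h
    · exact absurd h (noU _)
    · exact absurd h (noU _)
    · exact h.2.2
  obtain ⟨x, hx⟩ := Finite.exists_min (fun x => (f x).val)
  have lt : ∀ y, (SimpleGraph.cycleGraph (n + 4)).Adj x y → (f x).val < (f y).val := by
    intro y h
    refine lt_of_le_of_ne (hx y) fun he => ?_
    exact h.ne (f.injective (Fin.ext he))
  apply nadj x
  rw [← f.map_adj_iff, bigG_adj]
  refine ⟨fun h => two_ne x (f.injective h), Or.inr (Or.inr ⟨base _, base _, ?_⟩)⟩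
  exact hAdj_peo _ (base x) _ (base _) _ (base _) ⟨lt _ (adjS x), lt _ (adjP x),
    fun h => two_ne x (f.injective (Fin.ext h)), base2 _ _ (adjS x), base2 _ _ (adjP x)⟩

theorem bigG_conn (k : ℕ) (hk : 2 ≤ k) : HasConnectivity (bigG k) k := by
  classical
  have hUcard : (Finset.univ.filter
      (fun a : Fin (17 + 2 * k) => 18 ≤ a.val ∧ a.val < 18 + k)).card = k := by
    have : (Finset.univ.filter
      (fun a : Fin (17 + 2 * k) => 18 ≤ a.val ∧ a.val < 18 + k)).map Fin.valEmbedding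
        = Finset.Ico 18 (18 + k) := by
      ext i
      simp only [Finset.mem_map, Finset.mem_filter, Finset.mem_univ, true_and,
        Fin.valEmbedding_apply, Finset.mem_Ico]
      constructor
      · rintro ⟨a, h, rfl⟩; exact h
      · intro h; exact ⟨⟨i, by omega⟩, h, rfl⟩
    rw [← Finset.card_map Fin.valEmbedding, this]; simp
  set U := (Finset.univ.filter
      (fun a : Fin (17 + 2 * k) => 18 ≤ a.val ∧ a.val < 18 + k)) with hU
  constructor
  · refine ⟨U, hUcard, Or.inl fun hc => ?_⟩
    let a : ((↑U : Set (Fin (17 + 2 * k)))ᶜ : Set _) := ⟨⟨0, by omega⟩, by simp [hU]⟩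
    let b : ((↑U : Set (Fin (17 + 2 * k)))ᶜ : Set _) := ⟨⟨18 + k, by omega⟩, by simp [hU]⟩
    have hab : b ≠ a := by
      intro h
      have := congrArg (fun z => z.1.val) h
      simp [a, b] at this
    obtain ⟨w⟩ := hc.preconnected b a
    obtain ⟨z, h, -, -⟩ := w.exists_eq_cons_of_ne hab
    have hz := z.2
    simp [hU] at hz
    rw [SimpleGraph.induce_adj, bigG_adj] at h
    simp [b] at h
    omega
  · intro S hS
    by_contra! hlt
    obtain ⟨u, hu, huS⟩ : ∃ u ∈ U, u ∉ S := by
      by_contra! h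
      have := Finset.card_le_card (show U ⊆ S from h)
      omega
    have hu' : 18 ≤ u.val ∧ u.val < 18 + k := by simpa [hU] using hu
    rcases hS with hS | hS
    · apply hS
      have hr : ∀ x : ((↑S : Set (Fin (17 + 2 * k)))ᶜ : Set _),
          ((bigG k).induce ((↑S : Set (Fin (17 + 2 * k)))ᶜ)).Reachable x ⟨u, by simpa using huS⟩ := by
        intro x
        by_cases hx : x.1 = u
        · have : x = ⟨u, by simpa using huS⟩ := Subtype.ext hx
          rw [this]
        · apply SimpleGraph.Adj.reachable
          rw [SimpleGraph.induce_adj, bigG_adj]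
          exact ⟨hx, Or.inr (Or.inl hu')⟩
      have : Nonempty ((↑S : Set (Fin (17 + 2 * k)))ᶜ : Set _) := ⟨⟨u, by simpa using huS⟩⟩
      exact ⟨fun x y => (hr x).trans (hr y).symm⟩
    · have h1 : ((↑S : Set (Fin (17 + 2 * k)))ᶜ).ncard = (Sᶜ).card := by
        rw [← Finset.coe_compl, Set.ncard_coe_finset]
      rw [h1, Finset.card_compl, Fintype.card_fin] at hS
      omega

theorem base_walk (k : ℕ) (hk : 2 ≤ k) : ∀ (l : List ℕ) (x : ℕ) (hx : x < 17 + 2 * k),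
    (∀ y ∈ x :: l, y < 18) → (x :: l).Nodup → (x :: l).IsChain (fun a b => hAdj a b = true) →
    ∃ (b : Fin (17 + 2 * k)) (q : (bigG k).Walk ⟨x, hx⟩ b), q.IsPath ∧ b.val < 18 ∧
      ∀ v, v ∈ q.support ↔ v.val ∈ x :: l
  | [], x, hx, h1, _, _ => by
      refine ⟨⟨x, hx⟩, .nil, by simp, h1 x (by simp), ?_⟩
      intro v; simp [Fin.ext_iff]
  | y :: l, x, hx, h1, h2, h3 => by
      have hy : y < 18 := h1 y (by simp)
      have hx18 : x < 18 := h1 x (by simp)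
      have hyn : y < 17 + 2 * k := by omega
      obtain ⟨b, q, hq, hb, hs⟩ := base_walk k hk l y hyn
        (fun z hz => h1 z (List.mem_cons_of_mem _ hz)) h2.tail h3.tail
      have hxy : hAdj x y = true := by
        have := h3; simp at this; exact this.1
      have hne : x ∉ y :: l := (List.nodup_cons.1 h2).1
      have hadj : (bigG k).Adj ⟨x, hx⟩ ⟨y, hyn⟩ := by
        rw [bigG_adj]
        refine ⟨fun h => hne ?_, Or.inr (Or.inr ⟨hx18, hy, hxy⟩)⟩
        rw [Fin.ext_iff] at h
        simp only at h
        simp [h]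
      refine ⟨b, .cons hadj q, ?_, hb, ?_⟩
      · rw [SimpleGraph.Walk.cons_isPath_iff]
        exact ⟨hq, fun h => hne ((hs _).1 h)⟩
      · intro v
        rw [SimpleGraph.Walk.support_cons, List.mem_cons, hs, List.mem_cons (a := v.val) (b := x),
          Fin.ext_iff]

theorem upper_walk (k : ℕ) (hk : 2 ≤ k) (l : List ℕ) (x : ℕ)
    (h1 : ∀ y ∈ x :: l, y < 18) (h2 : (x :: l).Nodup)
    (h3 : (x :: l).IsChain (fun a b => hAdj a b = true)) : ∀ (d j : ℕ) (hj : j + d + 1 = k),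
    ∃ (b : Fin (17 + 2 * k)) (q : (bigG k).Walk ⟨18 + j, by omega⟩ b), q.IsPath ∧ b.val < 18 ∧
      ∀ v, v ∈ q.support ↔ (v.val ∈ x :: l ∨ (18 + j ≤ v.val ∧ v.val < 18 + k) ∨
        18 + k + j ≤ v.val)
  | 0, j, hj => by
      have hx : x < 18 := h1 x (by simp)
      obtain ⟨b, q, hq, hb, hs⟩ := base_walk k hk l x (by omega) h1 h2 h3
      have hadj : (bigG k).Adj ⟨18 + j, by omega⟩ ⟨x, by omega⟩ := by
        rw [bigG_adj]
        refine ⟨fun h => ?_, Or.inl ⟨by simp, by simp; omega⟩⟩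
        rw [Fin.ext_iff] at h
        simp only at h
        omega
      refine ⟨b, .cons hadj q, ?_, hb, ?_⟩
      · rw [SimpleGraph.Walk.cons_isPath_iff]
        refine ⟨hq, fun h => ?_⟩
        have := h1 _ ((hs _).1 h)
        simp only at this
        omega
      · intro v
        have hv := v.2
        rw [SimpleGraph.Walk.support_cons, List.mem_cons, hs, Fin.ext_iff]
        have e1 : v.val = 18 + j ↔ ((18 + j ≤ v.val ∧ v.val < 18 + k) ∨
          18 + k + j ≤ v.val) := by omega
        simp only [e1]
        tauto
  | d + 1, j, hj => by
      obtain ⟨b, q, hq, hb, hs⟩ := upper_walk k hk l x h1 h2 h3 d (j + 1) (by omega)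
      have hadj : (bigG k).Adj ⟨18 + k + j, by omega⟩ ⟨18 + (j + 1), by omega⟩ := by
        rw [bigG_adj]
        refine ⟨fun h => ?_, Or.inr (Or.inl ⟨by simp, by simp; omega⟩)⟩
        rw [Fin.ext_iff] at h
        simp only at h
        omega
      have hadj2 : (bigG k).Adj ⟨18 + j, by omega⟩ ⟨18 + k + j, by omega⟩ := by
        rw [bigG_adj]
        refine ⟨fun h => ?_, Or.inl ⟨by simp, by simp; omega⟩⟩
        rw [Fin.ext_iff] at h
        simp only at h
        omega
      have hno : ∀ n : ℕ, 18 ≤ n → n ∉ x :: l := fun n hn hmem => by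
        have := h1 n hmem
        omega
      refine ⟨b, .cons hadj2 (.cons hadj q), ?_, hb, ?_⟩
      · rw [SimpleGraph.Walk.cons_isPath_iff, SimpleGraph.Walk.cons_isPath_iff]
        refine ⟨⟨hq, fun h => ?_⟩, fun h => ?_⟩
        · rcases (hs _).1 h with h | h | h
          · exact hno _ (by simp; omega) h
          · simp only at h; omega
          · simp only at h; omega
        · rw [SimpleGraph.Walk.support_cons, List.mem_cons, hs, Fin.ext_iff] at h
          rcases h with h | h | h | h
          · simp only at h; omega
          · exact hno _ (by simp) h
          · simp only at h; omega
          · simp only at h; omega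
      · intro v
        have hv := v.2
        rw [SimpleGraph.Walk.support_cons, List.mem_cons, SimpleGraph.Walk.support_cons,
          List.mem_cons, hs, Fin.ext_iff, Fin.ext_iff]
        by_cases hm : v.val ∈ x :: l
        · simp [hm]
        · simp only [hm, false_or]
          omega

theorem big_cycle (k : ℕ) (hk : 2 ≤ k) (l : List ℕ) (x : ℕ)
    (h1 : ∀ y ∈ x :: l, y < 18) (h2 : (x :: l).Nodup)
    (h3 : (x :: l).IsChain (fun a b => hAdj a b = true)) :
    ∃ (b : Fin (17 + 2 * k)) (c : (bigG k).Walk b b), c.IsCycle ∧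
      ∀ v, v ∈ c.support ↔ (v.val ∈ x :: l ∨ 18 ≤ v.val) := by
  obtain ⟨b, q, hq, hb, hs⟩ := upper_walk k hk l x h1 h2 h3 (k - 2) 1 (by omega)
  have hadj : (bigG k).Adj ⟨18 + k, by omega⟩ ⟨18 + 1, by omega⟩ := by
    rw [bigG_adj]
    refine ⟨fun h => ?_, Or.inr (Or.inl ⟨by simp, by simp; omega⟩)⟩
    rw [Fin.ext_iff] at h
    simp only at h
    omega
  have hadj2 : (bigG k).Adj ⟨18, by omega⟩ ⟨18 + k, by omega⟩ := by
    rw [bigG_adj]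
    refine ⟨fun h => ?_, Or.inl ⟨by simp, by simp; omega⟩⟩
    rw [Fin.ext_iff] at h
    simp only at h
    omega
  have hadj3 : (bigG k).Adj b ⟨18, by omega⟩ := by
    rw [bigG_adj]
    refine ⟨fun h => ?_, Or.inr (Or.inl ⟨by simp, by simp; omega⟩)⟩
    rw [Fin.ext_iff] at h
    simp only at h
    omega
  have hno : ∀ n : ℕ, 18 ≤ n → n ∉ x :: l := fun n hn hmem => by
    have := h1 n hmem
    omega
  have hpath : (SimpleGraph.Walk.cons hadj q).IsPath := by
    rw [SimpleGraph.Walk.cons_isPath_iff]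
    refine ⟨hq, fun h => ?_⟩
    rcases (hs _).1 h with h | h | h
    · exact hno _ (by simp) h
    · simp only at h; omega
    · simp only at h; omega
  have hnot : (⟨18, by omega⟩ : Fin (17 + 2 * k)) ∉ (SimpleGraph.Walk.cons hadj q).support := by
    intro h
    rw [SimpleGraph.Walk.support_cons, List.mem_cons, hs, Fin.ext_iff] at h
    rcases h with h | h | h | h
    · simp only at h; omega
    · exact hno _ (by simp) h
    · simp only at h; omega
    · simp only at h; omega
  refine ⟨b, .cons hadj3 (.cons hadj2 (.cons hadj q)), ?_, ?_⟩
  · rw [SimpleGraph.Walk.cons_isCycle_iff]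
    refine ⟨?_, fun h => ?_⟩
    · rw [SimpleGraph.Walk.cons_isPath_iff]
      exact ⟨hpath, hnot⟩
    · rw [SimpleGraph.Walk.edges_cons, List.mem_cons] at h
      rcases h with h | h
      · rw [Sym2.eq_iff] at h
        simp only [Fin.ext_iff] at h
        omega
      · exact hnot (SimpleGraph.Walk.snd_mem_support_of_mem_edges _ h)
  · intro v
    have hv := v.2
    have hbs : v = b → (v.val ∈ x :: l ∨ (18 + 1 ≤ v.val ∧ v.val < 18 + k) ∨
        18 + k + 1 ≤ v.val) := by
      rintro rfl
      exact (hs _).1 q.end_mem_support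
    rw [SimpleGraph.Walk.support_cons, List.mem_cons, SimpleGraph.Walk.support_cons, List.mem_cons,
      SimpleGraph.Walk.support_cons, List.mem_cons, hs]
    by_cases hm : v.val ∈ x :: l
    · simp [hm]
    · simp only [hm, false_or] at hbs ⊢
      simp only [Fin.ext_iff] at hbs ⊢
      omega

theorem key_list (k : ℕ) : ∀ (l : List (Fin (17 + 2 * k))), l.IsChain (bigG k).Adj →
    (∃ u, l.getLast? = some u ∧ 18 ≤ u.val ∧ u.val < 18 + k) →
    ∀ hd : ℕ, (∀ y, l.head? = some y →
      hd = if 18 ≤ y.val ∧ y.val < 18 + k then 1 else 0) →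
    (l.countP (fun v => decide (18 + k ≤ v.val)) + hd ≤
      l.countP (fun v => decide (18 ≤ v.val ∧ v.val < 18 + k))) ∧
    (l.filter (fun v => decide (v.val < 18)) ≠ [] →
      l.countP (fun v => decide (18 + k ≤ v.val)) + hd + 1 ≤
      l.countP (fun v => decide (18 ≤ v.val ∧ v.val < 18 + k))) ∧
    (l.countP (fun v => decide (18 ≤ v.val ∧ v.val < 18 + k)) =
      l.countP (fun v => decide (18 + k ≤ v.val)) + hd + 1 →
      (l.filter (fun v => decide (v.val < 18))).IsChain (bigG k).Adj)
  | [], _, h, _, _ => by simp at h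
  | [x], _, h, hd, hhd => by
      simp at h
      have := hhd x rfl
      rw [if_pos h] at this
      subst this
      have h5 : ¬ (18 + k ≤ x.val) := by omega
      have h6 : ¬ (x.val < 18) := by omega
      simp [List.countP_cons, List.filter_cons, h, h5, h6]
  | x :: y :: t, hc, h, hd, hhd => by
      have hadj : (bigG k).Adj x y := by
        have := hc; simp at this; exact this.1
      have hdx := hhd x rfl
      obtain ⟨i1, i2, i3⟩ := key_list k (y :: t) hc.tail (by simpa using h)
        (if 18 ≤ y.val ∧ y.val < 18 + k then 1 else 0) (by simp)
      rw [bigG_adj] at hadj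
      replace hadj := hadj
      rw [List.countP_cons (a := x), List.countP_cons (a := x), List.filter_cons (x := x)]
      by_cases hxU : 18 ≤ x.val ∧ x.val < 18 + k
      · have n1 : ¬ (18 + k ≤ x.val) := by omega
        have n2 : ¬ (x.val < 18) := by omega
        rw [if_pos hxU] at hdx
        simp only [hxU, n1, n2, decide_true, decide_false, if_true, if_false,
          Bool.false_eq_true, and_self]
        refine ⟨by omega, fun hne => ?_, fun heq => ?_⟩
        · have := i2 hne; omega
        · by_cases hne : (y :: t).filter (fun v => decide (v.val < 18)) = []
          · rw [hne]; exact List.isChain_nil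
          · have := i2 hne
            exact i3 (by omega)
      · rw [if_neg hxU] at hdx
        by_cases hxI : 18 + k ≤ x.val
        · have n2 : ¬ (x.val < 18) := by omega
          have hy : 18 ≤ y.val ∧ y.val < 18 + k := by
            rcases hadj.2 with h | h | h
            · omega
            · exact h
            · omega
          rw [if_pos hy] at i1 i2 i3
          simp only [hxU, hxI, n2, decide_true, decide_false, if_true, if_false,
            Bool.false_eq_true]
          refine ⟨by omega, fun hne => ?_, fun heq => ?_⟩
          · have := i2 hne; omega
          · exact i3 (by omega)
        · have hxG : x.val < 18 := by omega
          simp only [hxU, hxI, hxG, decide_true, decide_false, if_true, if_false,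
            Bool.false_eq_true]
          by_cases hy : 18 ≤ y.val ∧ y.val < 18 + k
          · rw [if_pos hy] at i1 i2 i3
            refine ⟨by omega, fun _ => by omega, fun heq => ?_⟩
            by_cases hne : (y :: t).filter (fun v => decide (v.val < 18)) = []
            · rw [hne]; exact List.isChain_singleton _
            · have := i2 hne
              omega
          · rw [if_neg hy] at i1 i2 i3
            have hyG : y.val < 18 := by
              rcases hadj.2 with h | h | h
              · omega
              · exact absurd h hy
              · exact h.2.1
            have hf : (y :: t).filter (fun v => decide (v.val < 18)) =
                y :: t.filter (fun v => decide (v.val < 18)) := by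
              rw [List.filter_cons]; simp [hyG]
            rw [hf] at i2 i3 ⊢
            have := i2 (by simp)
            refine ⟨by omega, fun _ => by omega, fun heq => ?_⟩
            have := i3 (by omega)
            rw [List.isChain_cons_cons]
            exact ⟨(bigG_adj k x y).2 hadj, this⟩

theorem bigG_not_ext (k : ℕ) (hk : 2 ≤ k) : ¬ CycleExtendible (bigG k) := by
  intro hext
  obtain ⟨a, c, hc, hcs⟩ := big_cycle k hk [12, 15, 3, 14, 8, 2, 6, 9, 5, 7, 16, 4, 17, 13, 1] 0
    (by decide) (by decide) (by decide)
  have hmem : ∀ v, v ∈ c.support ↔ (v.val ≠ 10 ∧ v.val ≠ 11) := by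
    intro v
    rw [hcs]
    simp only [List.mem_cons, List.not_mem_nil, or_false]
    omega
  obtain ⟨b, c', hc', hsub, hcard⟩ := hext a c hc (by
    intro h
    have : (⟨10, by omega⟩ : Fin (17 + 2 * k)) ∈ c.support.toFinset := by rw [h]; simp
    rw [List.mem_toFinset, hmem] at this
    exact this.1 rfl)
  obtain ⟨w, hw, hins⟩ := (Finset.exists_eq_insert_iff (s := c.support.toFinset)
    (t := c'.support.toFinset)).2 ⟨hsub.1, hcard.symm⟩
  have hw' : w.val = 10 ∨ w.val = 11 := by
    rw [List.mem_toFinset, hmem] at hw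
    omega
  have hmem' : ∀ v, v ∈ c'.support ↔ (v = w ∨ (v.val ≠ 10 ∧ v.val ≠ 11)) := by
    intro v
    rw [← List.mem_toFinset, ← hins, Finset.mem_insert, List.mem_toFinset, hmem]
  -- rotate to start at a universal vertex
  have hu : (⟨18, by omega⟩ : Fin (17 + 2 * k)) ∈ c'.support := by
    rw [hmem']; right; simp
  have hd := hc'.rotate hu
  have hdm : ∀ v, v ∈ (c'.rotate _ hu).support ↔ v ∈ c'.support := fun v =>
    SimpleGraph.Walk.mem_support_rotate_iff _ _ _
  generalize c'.rotate _ hu = d at hd hdm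
  have hnil : ¬ d.Nil := hd.not_nil
  set l := d.support.tail with hl
  have hlm : ∀ v, v ∈ l ↔ (v = w ∨ (v.val ≠ 10 ∧ v.val ≠ 11)) := by
    intro v
    rw [← hmem', ← hdm]
    constructor
    · exact fun h => List.mem_of_mem_tail h
    · intro h
      rcases (SimpleGraph.Walk.mem_support_iff d).1 h with rfl | h
      · exact SimpleGraph.Walk.end_mem_tail_support hnil
      · exact h
  have hnd : l.Nodup := hd.support_nodup
  have hchain : l.IsChain (bigG k).Adj := d.isChain_adj_support.tail
  have hlast : l.getLast? = some (⟨18, by omega⟩ : Fin (17 + 2 * k)) := by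
    have hne : l ≠ [] := by
      intro h
      have := (hlm ⟨18, by omega⟩).2 (Or.inr (by simp))
      rw [h] at this
      simp at this
    rw [List.getLast?_eq_some_getLast hne]
    simp only [hl]
    rw [List.getLast_tail]
    simp
  have hcU : l.countP (fun v => decide (18 ≤ v.val ∧ v.val < 18 + k)) = k := by
    have : ((l.filter (fun v => decide (18 ≤ v.val ∧ v.val < 18 + k))).map Fin.val).Perm
        (List.range' 18 k) := by
      rw [List.perm_ext_iff_of_nodup ((hnd.filter _).map Fin.val_injective) List.nodup_range']
      intro i
      simp only [List.mem_map, List.mem_filter, hlm, decide_eq_true_eq, List.mem_range'_1]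
      constructor
      · rintro ⟨v, h, rfl⟩; omega
      · intro h
        exact ⟨⟨i, by omega⟩, ⟨Or.inr (by simp; omega), by simp; omega⟩, rfl⟩
    have := this.length_eq
    rw [List.length_map, List.length_range'] at this
    rw [List.countP_eq_length_filter, this]
  have hcI : l.countP (fun v => decide (18 + k ≤ v.val)) = k - 1 := by
    have : ((l.filter (fun v => decide (18 + k ≤ v.val))).map Fin.val).Perm
        (List.range' (18 + k) (k - 1)) := by
      rw [List.perm_ext_iff_of_nodup ((hnd.filter _).map Fin.val_injective) List.nodup_range']
      intro i
      simp only [List.mem_map, List.mem_filter, hlm, decide_eq_true_eq, List.mem_range'_1]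
      constructor
      · rintro ⟨v, h, rfl⟩; omega
      · intro h
        exact ⟨⟨i, by omega⟩, ⟨Or.inr (by simp; omega), by simp; omega⟩, rfl⟩
    have := this.length_eq
    rw [List.length_map, List.length_range'] at this
    rw [List.countP_eq_length_filter, this]
  have hG : ((l.filter (fun v => decide (v.val < 18))).map Fin.val).Perm
      ((List.range 18).erase (21 - w.val)) := by
    rw [List.perm_ext_iff_of_nodup ((hnd.filter _).map Fin.val_injective)
      (List.nodup_range.erase _)]
    intro i
    rw [List.nodup_range.mem_erase_iff]
    simp only [List.mem_map, List.mem_filter, hlm, decide_eq_true_eq, List.mem_range, Fin.ext_iff]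
    constructor
    · rintro ⟨v, h, rfl⟩; omega
    · intro h
      exact ⟨⟨i, by omega⟩, ⟨by simp only; omega, by simp only; omega⟩, rfl⟩
  have hne : l.filter (fun v => decide (v.val < 18)) ≠ [] := by
    intro h
    have := hG.length_eq
    rw [h] at this
    rcases hw' with h | h <;> simp [h] at this
  obtain ⟨y, hy⟩ : ∃ y, l.head? = some y := by
    cases hh : l with
    | nil => rw [hh] at hne; simp at hne
    | cons y t => exact ⟨y, rfl⟩
  obtain ⟨-, k2, k3⟩ := key_list k l hchain ⟨_, hlast, by simp, by simp; omega⟩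
    (if 18 ≤ y.val ∧ y.val < 18 + k then 1 else 0) (by
      intro z hz
      rw [hy] at hz
      cases hz
      rfl)
  have k2 := k2 hne
  rw [hcU, hcI] at k2 k3
  have k3 := k3 (by omega)
  refine no_path (21 - w.val) (by omega) _ hG ?_
  rw [List.isChain_map]
  have hall : ∀ v ∈ l.filter (fun v => decide (v.val < 18)), v.val < 18 := by
    intro v hv
    simpa using (List.mem_filter.1 hv).2
  refine List.IsChain.imp_of_mem_imp ?_ k3
  intro p q hp hq hpq
  have hp := hall p hp
  have hq := hall q hq
  rw [bigG_adj] at hpq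
  rcases hpq.2 with h | h | h
  · omega
  · omega
  · exact ⟨h.2.2, hAdj_symm _ hp _ hq h.2.2⟩

theorem bigG_ham (k : ℕ) (hk : 2 ≤ k) : (bigG k).IsHamiltonian := by
  intro _
  obtain ⟨a, c, hc, hcs⟩ := big_cycle k hk
    [12, 16, 4, 17, 11, 10, 9, 5, 7, 8, 2, 6, 15, 3, 14, 13, 1] 0
    (by decide) (by decide) (by decide)
  refine ⟨a, c, ?_⟩
  rw [SimpleGraph.Walk.isHamiltonianCycle_iff_isCycle_and_support_count_tail_eq_one]
  refine ⟨hc, fun v => List.count_eq_one_of_mem hc.support_nodup ?_⟩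
  have h : v ∈ c.support := by
    rw [hcs]
    simp only [List.mem_cons, List.not_mem_nil, or_false]
    omega
  rcases (SimpleGraph.Walk.mem_support_iff c).1 h with rfl | h
  · exact SimpleGraph.Walk.end_mem_tail_support hc.not_nil
  · exact h

theorem stmt10 (k : ℕ) (hk : 2 ≤ k) :
    ∃ (n : ℕ) (G : SimpleGraph (Fin n)), IsChordal G ∧ G.IsHamiltonian ∧
      HasConnectivity G k ∧ ¬ CycleExtendible G :=
  ⟨_, bigG k, bigG_chordal k, bigG_ham k hk, bigG_conn k hk, bigG_not_ext k hk⟩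
end

section
/- For every finite nonempty set S of positive integers, there exist infinitely many graphs that are chordal and Hamiltonian but not S-cycle extendible. -/
/-- A cycle `C` of `G` is `S`-extendible if there is a cycle `C'` with
`V(C) ⊂ V(C')` and `|V(C')| - |V(C)| ∈ S`. -/
def SExtendible {V : Type*} [Fintype V] [DecidableEq V] (G : SimpleGraph V) (S : Finset ℕ)
    {a : V} (c : G.Walk a a) : Prop :=
  ∃ (b : V) (c' : G.Walk b b), c'.IsCycle ∧ c.support.toFinset ⊂ c'.support.toFinset ∧
    c'.support.toFinset.card - c.support.toFinset.card ∈ S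

/-- `G` is `S`-cycle extendible if every cycle of `G` that could be `S`-extendible
(i.e. some `s ∈ S` additional vertices are available) is `S`-extendible. -/
def SCycleExtendible {V : Type*} [Fintype V] [DecidableEq V] (G : SimpleGraph V)
    (S : Finset ℕ) : Prop :=
  ∀ (a : V) (c : G.Walk a a), c.IsCycle →
    (∃ s ∈ S, c.support.toFinset.card + s ≤ Fintype.card V) → SExtendible G S c

/-- Oriented edges (from the earlier to the later vertex) of the graph. -/
def EE (m a b : ℕ) : Prop :=
  (a = 0 ∧ (b = m+7 ∨ b = m+10)) ∨ (a = 1 ∧ (b = 5 ∨ b = m+11)) ∨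
  (a = 2 ∧ (b = m+9 ∨ b = m+11)) ∨ (a = 3 ∧ (b = 6 ∨ b = m+12)) ∨
  (a = 4 ∧ (b = m+8 ∨ b = m+12)) ∨ (5 ≤ a ∧ a ≤ m+9 ∧ b = a+1) ∨
  (5 ≤ a ∧ a < b ∧ m+10 ≤ b ∧ b ≤ m+12)

/-- Adjacency on natural numbers. -/
def AA (m a b : ℕ) : Prop := EE m a b ∨ EE m b a

/-- The graph. -/
def GG (m : ℕ) : SimpleGraph (Fin (m+13)) where
  Adj a b := AA m a.1 b.1
  symm := ⟨fun a b h => Or.symm h⟩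
  loopless := ⟨fun a h => by unfold AA EE at h; omega⟩

theorem chordal_of_peo {n : ℕ} (G : SimpleGraph (Fin n))
    (h : ∀ a b c : Fin n, a < b → a < c → G.Adj a b → G.Adj a c → b ≠ c → G.Adj b c) :
    IsChordal G := by
  intro k hk
  refine ⟨fun f => ?_⟩
  obtain ⟨k, rfl⟩ : ∃ j, k = j + 4 := ⟨k - 4, by omega⟩
  obtain ⟨i, hi⟩ := Finite.exists_min (fun i => f i)
  have h1 : (SimpleGraph.cycleGraph (k+4)).Adj i (i+1) := by
    rw [SimpleGraph.cycleGraph_adj (n := k+2)]; right; simp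
  have h2 : (SimpleGraph.cycleGraph (k+4)).Adj i (i-1) := by
    rw [SimpleGraph.cycleGraph_adj (n := k+2)]; left; simp
  have two : ((1:Fin (k+4)) + 1 ).val = 2 := by
    rw [Fin.val_add]; simp; 
  have three : ((1:Fin (k+4)) + 1 + 1).val = 3 := by
    rw [Fin.val_add, two]; simp; 
  have hne : i + 1 ≠ i - 1 := by
    intro h
    have h3 : (1:Fin (k+4)) + 1 = 0 := by
      have := congrArg (fun x => x - i + 1) h
      rw [show i + 1 - i + 1 = 1 + 1 by abel, show i - 1 - i + 1 = 0 by abel] at this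
      exact this
    rw [h3] at two; simp at two
  have hlt : ∀ j, (SimpleGraph.cycleGraph (k+4)).Adj i j → f i < f j := fun j hj =>
    lt_of_le_of_ne (hi j) (fun e => hj.ne (f.injective e))
  have h3 := h _ _ _ (hlt _ h1) (hlt _ h2) (f.map_rel_iff.2 h1) (f.map_rel_iff.2 h2)
    (fun e => hne (f.injective e))
  have h4 := f.map_rel_iff.1 h3
  rw [SimpleGraph.cycleGraph_adj (n := k+2)] at h4
  rcases h4 with h4 | h4
  · have h5 : (1:Fin (k+4)) + 1 = 1 := by
      rw [← h4]
      rw [show i + 1 - (i-1) = 1 + 1 by abel]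
      rw [show i + 1 - (i-1) = 1 + 1 by abel] at h4
      rw [h4, h4]
    have := congrArg Fin.val h5
    rw [two] at this; simp at this
  · have h5 : (1:Fin (k+4)) + 1 + 1 = 0 := by
      nth_rewrite 1 [← h4]
      abel
    have := congrArg Fin.val h5
    rw [three] at this; simp at this

theorem EE_lt {m a b : ℕ} (h : EE m a b) : a < b := by
  unfold EE at h; omega

theorem EE_peo {m a b c : ℕ} (h1 : EE m a b) (h2 : EE m a c) (h : b < c) : EE m b c := by
  have : 5 ≤ b ∧ b < c ∧ m+10 ≤ c ∧ c ≤ m+12 := by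
    unfold EE at h1 h2
    refine ⟨?_, h, ?_, ?_⟩ <;> omega
  unfold EE
  exact Or.inr (Or.inr (Or.inr (Or.inr (Or.inr (Or.inr this)))))

theorem chordal_GG (m : ℕ) : IsChordal (GG m) := by
  apply chordal_of_peo
  intro a b c h1 h2 h3 h4 h5
  have h5' : a.1 < b.1 := h1
  have h6' : a.1 < c.1 := h2
  have h3' : EE m a.1 b.1 := h3.resolve_right (fun h => by have := EE_lt h; omega)
  have h4' : EE m a.1 c.1 := h4.resolve_right (fun h => by have := EE_lt h; omega)
  rcases lt_trichotomy b.1 c.1 with h | h | h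
  · exact Or.inl (EE_peo h3' h4' h)
  · exact absurd (Fin.ext h) h5
  · exact Or.inr (EE_peo h4' h3' h)

theorem AA_symm {m a b : ℕ} (h : AA m a b) : AA m b a := Or.symm h
theorem aa0 (m : ℕ) : AA m 0 (m+7) := Or.inl (by simp [EE])
theorem aa0' (m : ℕ) : AA m 0 (m+10) := Or.inl (by simp [EE])
theorem aa1 (m : ℕ) : AA m 1 5 := Or.inl (by simp [EE])
theorem aa1' (m : ℕ) : AA m 1 (m+11) := Or.inl (by simp [EE])
theorem aa2 (m : ℕ) : AA m 2 (m+9) := Or.inl (by simp [EE])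
theorem aa2' (m : ℕ) : AA m 2 (m+11) := Or.inl (by simp [EE])
theorem aa3 (m : ℕ) : AA m 3 6 := Or.inl (by simp [EE])
theorem aa3' (m : ℕ) : AA m 3 (m+12) := Or.inl (by simp [EE])
theorem aa4 (m : ℕ) : AA m 4 (m+8) := Or.inl (by simp [EE])
theorem aa4' (m : ℕ) : AA m 4 (m+12) := Or.inl (by simp [EE])
theorem aap {m a : ℕ} (h : 5 ≤ a) (h' : a ≤ m+9) : AA m a (a+1) :=
  Or.inl (Or.inr (Or.inr (Or.inr (Or.inr (Or.inr (Or.inl ⟨h, h', rfl⟩))))))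
theorem aau {m a b : ℕ} (h : 5 ≤ a) (h1 : a < b) (h2 : m+10 ≤ b) (h3 : b ≤ m+12) : AA m a b :=
  Or.inl (Or.inr (Or.inr (Or.inr (Or.inr (Or.inr (Or.inr ⟨h, h1, h2, h3⟩))))))

theorem ex_walk (m : ℕ) : ∀ (l : List ℕ) (a b : Fin (m+13)), List.IsChain (AA m) (a.1 :: l) →
    (∀ x ∈ l, x < m+13) → (a.1 :: l).getLast (by simp) = b.1 →
    ∃ p : (GG m).Walk a b, p.support.map Fin.val = a.1 :: l := by
  intro l
  induction l with
  | nil =>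
    intro a b _ _ h
    obtain rfl : a = b := Fin.ext (by simpa using h)
    exact ⟨.nil, by simp⟩
  | cons x l ih =>
    intro a b hc hb h
    have hx : x < m+13 := hb x (by simp)
    rw [List.isChain_cons_cons] at hc
    obtain ⟨p, hp⟩ := ih ⟨x, hx⟩ b hc.2 (fun y hy => hb y (by simp [hy])) (by simpa using h)
    have hadj : (GG m).Adj a ⟨x, hx⟩ := hc.1
    exact ⟨.cons hadj p, by simp [hp]⟩

theorem ex_cycle (m : ℕ) (l : List ℕ) (a : Fin (m+13)) (h1 : List.IsChain (AA m) (a.1 :: l))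
    (h2 : ∀ x ∈ l, x < m+13) (h3 : (a.1 :: l).getLast (by simp) = a.1)
    (h4 : l.Nodup) (h5 : 3 ≤ l.length) :
    ∃ p : (GG m).Walk a a, p.IsCycle ∧ p.length = l.length ∧ p.support.map Fin.val = a.1 :: l := by
  obtain ⟨p, hp⟩ := ex_walk m l a a h1 h2 h3
  have hl : p.length = l.length := by
    have := congrArg List.length hp
    simpa using this
  refine ⟨p, ?_, hl, hp⟩
  rw [SimpleGraph.Walk.isCycle_iff_isPath_tail_and_le_length]
  refine ⟨?_, by omega⟩
  rw [SimpleGraph.Walk.isPath_def, SimpleGraph.Walk.support_tail_of_not_nil]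
  · have : (p.support.tail).map Fin.val = l := by rw [List.map_tail, hp]; rfl
    rw [← this] at h4
    exact h4.of_map
  · intro h
    have := SimpleGraph.Walk.length_eq_zero_iff.2 h
    omega

theorem ham_GG (m : ℕ) : (GG m).IsHamiltonian := by
  intro _
  obtain ⟨p, hp, hl, -⟩ := ex_cycle m ([5, 1, m+11, 2, m+9, m+8, 4, m+12, 3] ++
      (List.range' 6 (m+2) ++ [0, m+10])) ⟨m+10, by omega⟩ (by
      simp only [List.cons_append, List.nil_append, List.isChain_cons_cons]
      refine ⟨AA_symm (aau (by omega) (by omega) (by omega) (by omega)), AA_symm (aa1 m), aa1' m,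
        AA_symm (aa2' m), aa2 m, AA_symm (aap (by omega) (by omega)), AA_symm (aa4 m), aa4' m,
        AA_symm (aa3' m), ?_⟩
      rw [List.range'_succ]
      simp only [List.cons_append, List.isChain_cons_cons]
      refine ⟨aa3 m, ?_⟩
      rw [← List.cons_append, ← List.range'_succ, List.isChain_append]
      refine ⟨?_, ?_, ?_⟩
      · rw [List.isChain_iff_getElem]
        intro i hi
        simp only [List.length_range'] at hi
        simp only [List.getElem_range']
        have := aap (m := m) (a := 6 + 1 * i) (by omega) (by omega)
        exact this
      · simp only [List.isChain_cons_cons, List.isChain_singleton]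
        exact ⟨aa0' m, trivial⟩
      · intro x hx y hy
        rw [List.getLast?_range'] at hx
        simp at hx hy
        subst hx hy
        have := AA_symm (aa0 m)
        rw [show 6 + (m + 1) = m + 7 by omega]
        exact this)
    (by
      intro x hx
      simp [List.mem_range'] at hx
      omega) (by simp) (by
      rw [List.nodup_append, List.nodup_append]
      refine ⟨by simp, ⟨List.nodup_range', by simp, ?_⟩, ?_⟩
      · intro a ha b hb
        simp [List.mem_range'] at ha hb
        omega
      · intro a ha b hb
        simp [List.mem_range'] at ha hb
        omega) (by simp)
  refine ⟨_, p, ?_⟩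
  rw [SimpleGraph.Walk.isHamiltonianCycle_iff_isCycle_and_length_eq]
  refine ⟨hp, ?_⟩
  rw [hl]; simp

theorem base_cycle (m : ℕ) : ∃ (a : Fin (m+13)) (p : (GG m).Walk a a), p.IsCycle ∧
    ∀ x : Fin (m+13), x ∈ p.support ↔ ¬ (7 ≤ x.1 ∧ x.1 ≤ m+6) := by
  obtain ⟨p, hp, hl, hs⟩ := ex_cycle m [0, m+7, m+8, 4, m+12, 3, 6, 5, 1, m+11, 2, m+9, m+10]
    ⟨m+10, by omega⟩ (by
      simp only [List.isChain_cons_cons, List.isChain_singleton]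
      exact ⟨AA_symm (aa0' m), aa0 m, aap (by omega) (by omega), AA_symm (aa4 m), aa4' m,
        AA_symm (aa3' m), aa3 m, AA_symm (aap (by omega) (by omega)), AA_symm (aa1 m), aa1' m,
        AA_symm (aa2' m), aa2 m, aap (by omega) (by omega), trivial⟩)
    (by intro x hx; simp at hx; omega) (by simp) (by simp) (by simp)
  refine ⟨_, p, hp, fun x => ?_⟩
  have : x ∈ p.support ↔ x.1 ∈ p.support.map Fin.val := by
    simp [Fin.val_inj]
  rw [this, hs]
  have := x.2
  simp only [List.mem_cons, List.not_mem_nil, or_false]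
  omega

theorem nn0 {m b : ℕ} (h : AA m 0 b) : b = m+7 ∨ b = m+10 := by unfold AA EE at h; omega
theorem nn1 {m b : ℕ} (h : AA m 1 b) : b = 5 ∨ b = m+11 := by unfold AA EE at h; omega
theorem nn2 {m b : ℕ} (h : AA m 2 b) : b = m+9 ∨ b = m+11 := by unfold AA EE at h; omega
theorem nn3 {m b : ℕ} (h : AA m 3 b) : b = 6 ∨ b = m+12 := by unfold AA EE at h; omega
theorem nn4 {m b : ℕ} (h : AA m 4 b) : b = m+8 ∨ b = m+12 := by unfold AA EE at h; omega
theorem nn5 {m b : ℕ} (hm : 1 ≤ m) (h : AA m 5 b) :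
    b = 1 ∨ b = 6 ∨ b = m+10 ∨ b = m+11 ∨ b = m+12 := by unfold AA EE at h; omega
theorem nn6 {m b : ℕ} (hm : 1 ≤ m) (h : AA m 6 b) :
    b = 3 ∨ b = 5 ∨ b = 7 ∨ b = m+10 ∨ b = m+11 ∨ b = m+12 := by unfold AA EE at h; omega
theorem nny {m y b : ℕ} (h1 : 7 ≤ y) (h2 : y ≤ m+6) (h : AA m y b) :
    b = y+1 ∨ b+1 = y ∨ b = m+10 ∨ b = m+11 ∨ b = m+12 := by unfold AA EE at h; omega
theorem nn7 {m b : ℕ} (h : AA m (m+7) b) :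
    b = 0 ∨ b = m+6 ∨ b = m+8 ∨ b = m+10 ∨ b = m+11 ∨ b = m+12 := by unfold AA EE at h; omega
theorem nn8 {m b : ℕ} (h : AA m (m+8) b) :
    b = 4 ∨ b = m+7 ∨ b = m+9 ∨ b = m+10 ∨ b = m+11 ∨ b = m+12 := by unfold AA EE at h; omega
theorem nn9 {m b : ℕ} (h : AA m (m+9) b) :
    b = 2 ∨ b = m+8 ∨ b = m+10 ∨ b = m+11 ∨ b = m+12 := by unfold AA EE at h; omega
theorem nnz {m b : ℕ} (h : AA m (m+10) b) :
    b = 0 ∨ (5 ≤ b ∧ b ≤ m+9) ∨ b = m+11 ∨ b = m+12 := by unfold AA EE at h; omega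

theorem core (m : ℕ) (R : ℕ → ℕ → Prop) (hs : ∀ a b, R a b → R b a)
    (hA : ∀ a b, R a b → AA m a b)
    (hex : ∀ a b, R a b → ∃ c, c ≠ b ∧ R a c ∧ ∀ d, R a d → d = b ∨ d = c)
    (hX : ∀ a, a < m+13 → ¬ (7 ≤ a ∧ a ≤ m+6) → ∃ b, R a b)
    (hconn : ∀ T : ℕ → Prop, (∀ a b, T a → R a b → T b) → T (m+10) → T 1)
    (y : ℕ) (hy1 : 7 ≤ y) (hy2 : y ≤ m+6) (hyR : ∃ b, R y b) :
    ∀ x, 7 ≤ x → x ≤ m+6 → ∃ b, R x b := by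
  have hm : 1 ≤ m := by omega
  have two : ∀ a p q, (∃ b, R a b) → (∀ b, R a b → b = p ∨ b = q) → R a p ∧ R a q := by
    rintro a p q ⟨b, hb⟩ h
    obtain ⟨c, hc, hc', -⟩ := hex a b hb
    rcases h b hb with rfl | rfl <;> rcases h c hc' with rfl | rfl <;> tauto
  have sat : ∀ a p q, p ≠ q → R a p → R a q → ∀ d, R a d → d = p ∨ d = q := by
    intro a p q hpq hp hq d hd
    obtain ⟨c, hc, hc', hall⟩ := hex a p hp
    rcases hall q hq with h | h
    · exact absurd h.symm hpq
    · subst h; exact hall d hd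
  obtain ⟨h07, h010⟩ := two 0 _ _ (hX 0 (by omega) (by omega)) (fun b hb => nn0 (hA _ _ hb))
  obtain ⟨h15, h111⟩ := two 1 _ _ (hX 1 (by omega) (by omega)) (fun b hb => nn1 (hA _ _ hb))
  obtain ⟨h29, h211⟩ := two 2 _ _ (hX 2 (by omega) (by omega)) (fun b hb => nn2 (hA _ _ hb))
  obtain ⟨h36, h312⟩ := two 3 _ _ (hX 3 (by omega) (by omega)) (fun b hb => nn3 (hA _ _ hb))
  obtain ⟨h48, h412⟩ := two 4 _ _ (hX 4 (by omega) (by omega)) (fun b hb => nn4 (hA _ _ hb))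
  have v1 := sat (m+11) 1 2 (by omega) (hs _ _ h111) (hs _ _ h211)
  have v2 := sat (m+12) 3 4 (by omega) (hs _ _ h312) (hs _ _ h412)
  have nv1 : ∀ a, 5 ≤ a → ¬ R a (m+11) := fun a ha h => by
    have := v1 _ (hs _ _ h); omega
  have nv2 : ∀ a, 5 ≤ a → ¬ R a (m+12) := fun a ha h => by
    have := v2 _ (hs _ _ h); omega
  obtain ⟨x5, n5, r5, u5⟩ := hex 5 1 (hs _ _ h15)
  obtain ⟨x6, n6, r6, u6⟩ := hex 6 3 (hs _ _ h36)
  obtain ⟨x7, n7, r7, u7⟩ := hex (m+7) 0 (hs _ _ h07)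
  obtain ⟨x8, n8, r8, u8⟩ := hex (m+8) 4 (hs _ _ h48)
  obtain ⟨x9, n9, r9, u9⟩ := hex (m+9) 2 (hs _ _ h29)
  obtain ⟨xz, nz, rz, uz⟩ := hex (m+10) 0 (hs _ _ h010)
  have o5 : x5 = 6 ∨ x5 = m+10 := by
    rcases nn5 hm (hA _ _ r5) with h | h | h | h | h
    · omega
    · omega
    · omega
    · subst h; exact absurd r5 (nv1 _ (by omega))
    · subst h; exact absurd r5 (nv2 _ (by omega))
  have o6 : x6 = 5 ∨ x6 = 7 ∨ x6 = m+10 := by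
    rcases nn6 hm (hA _ _ r6) with h | h | h | h | h | h
    · omega
    · omega
    · omega
    · omega
    · subst h; exact absurd r6 (nv1 _ (by omega))
    · subst h; exact absurd r6 (nv2 _ (by omega))
  have o7 : x7 = m+6 ∨ x7 = m+8 ∨ x7 = m+10 := by
    rcases nn7 (hA _ _ r7) with h | h | h | h | h | h
    · omega
    · omega
    · omega
    · omega
    · subst h; exact absurd r7 (nv1 _ (by omega))
    · subst h; exact absurd r7 (nv2 _ (by omega))
  have o8 : x8 = m+7 ∨ x8 = m+9 ∨ x8 = m+10 := by
    rcases nn8 (hA _ _ r8) with h | h | h | h | h | h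
    · omega
    · omega
    · omega
    · omega
    · subst h; exact absurd r8 (nv1 _ (by omega))
    · subst h; exact absurd r8 (nv2 _ (by omega))
  have o9 : x9 = m+8 ∨ x9 = m+10 := by
    rcases nn9 (hA _ _ r9) with h | h | h | h | h
    · omega
    · omega
    · omega
    · subst h; exact absurd r9 (nv1 _ (by omega))
    · subst h; exact absurd r9 (nv2 _ (by omega))
  have oz : 5 ≤ xz ∧ xz ≤ m+9 := by
    rcases nnz (hA _ _ rz) with h | h | h | h
    · omega
    · omega
    · subst h; exact absurd rz (nv1 _ (by omega))
    · subst h; exact absurd rz (nv2 _ (by omega))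
  have oy : ∀ y b, 7 ≤ y → y ≤ m+6 → R y b → b = y+1 ∨ b+1 = y ∨ b = m+10 := by
    intro y b h1 h2 hb
    rcases nny h1 h2 (hA _ _ hb) with h | h | h | h | h
    · omega
    · omega
    · omega
    · subst h; exact absurd hb (nv1 _ (by omega))
    · subst h; exact absurd hb (nv2 _ (by omega))
  rcases o5 with e5 | e5
  · -- s1 s2 is an edge
    subst e5
    have e6 : x6 = 5 := by
      have := u6 5 (hs _ _ r5); omega
    subst e6
    rcases o9 with e9 | e9
    · -- t1 t3 is an edge; the set consisting of z, w0, t2 and Y is closed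
      subst e9
      have e8 : x8 = m+9 := by
        have := u8 (m+9) (hs _ _ r9); omega
      subst e8
      have ez : xz = m+7 ∨ (7 ≤ xz ∧ xz ≤ m+6) := by
        have hz := hs _ _ rz
        rcases Nat.lt_or_ge xz 7 with h | h
        · have : xz = 5 ∨ xz = 6 := by omega
          rcases this with rfl | rfl
          · have := u5 _ hz; omega
          · have := u6 _ hz; omega
        · have : xz = m+8 ∨ xz = m+9 ∨ xz ≤ m+7 := by omega
          rcases this with rfl | rfl | h'
          · have := u8 _ hz; omega
          · have := u9 _ hz; omega
          · omega
      have e7 : x7 = m+6 ∨ x7 = m+10 := by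
        rcases o7 with h | h | h
        · exact Or.inl h
        · subst h
          have := u8 _ (hs _ _ r7); omega
        · exact Or.inr h
      exfalso
      have := hconn (fun a => a = 0 ∨ (7 ≤ a ∧ a ≤ m+7) ∨ a = m+10) (by
        rintro a b (rfl | h | rfl) hab
        · have := nn0 (hA _ _ hab); omega
        · rcases Nat.lt_or_ge a (m+7) with h' | h'
          · rcases oy a b h.1 (by omega) hab with h1 | h1 | h1
            · omega
            · rcases Nat.lt_or_ge b 7 with h2 | h2
              · obtain rfl : b = 6 := by omega
                have := u6 _ (hs _ _ hab); omega
              · omega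
            · omega
          · obtain rfl : a = m+7 := by omega
            have := u7 _ hab; omega
        · have := uz _ hab; omega) (by simp)
      omega
    · -- z t1 is an edge; then Y cannot be used
      subst e9
      have ez : xz = m+9 := by
        have := uz (m+9) (hs _ _ r9); omega
      subst ez
      have e8 : x8 = m+7 := by
        rcases o8 with h | h | h
        · exact h
        · subst h
          have := u9 _ (hs _ _ r8); omega
        · subst h
          have := uz _ (hs _ _ r8); omega
      subst e8
      have e7 : x7 = m+8 := by
        have := u7 _ (hs _ _ r8); omega
      subst e7
      exfalso
      have key : ∀ k, ∀ y, y = 7 + k → y ≤ m+6 → ¬ ∃ b, R y b := by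
        intro k
        induction k with
        | zero =>
          rintro y hy1 hy2 ⟨b, hb⟩
          obtain ⟨c, hc, hc', hall⟩ := hex _ _ hb
          have hno : ∀ d, R y d → d = y+1 := by
            intro d hd
            rcases oy y d (by omega) hy2 hd with h | h | h
            · exact h
            · obtain rfl : d = 6 := by omega
              have := u6 _ (hs _ _ hd); omega
            · subst h
              have := uz _ (hs _ _ hd); omega
          have h1 := hno _ hb
          have h2 := hno _ hc'
          omega
        | succ k ih =>
          rintro y hy1 hy2 ⟨b, hb⟩
          obtain ⟨c, hc, hc', hall⟩ := hex _ _ hb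
          have hno : ∀ d, R y d → d = y+1 := by
            intro d hd
            rcases oy y d (by omega) hy2 hd with h | h | h
            · exact h
            · exact absurd ⟨y, hs _ _ hd⟩ (ih d (by omega) (by omega))
            · subst h
              have := uz _ (hs _ _ hd); omega
          have h1 := hno _ hb
          have h2 := hno _ hc'
          omega
      exact key (y - 7) y (by omega) hy2 hyR
  · -- z s1 is an edge; then all of Y is used
    subst e5
    have ez : xz = 5 := by
      have := uz _ (hs _ _ r5); omega
    subst ez
    have e6 : x6 = 7 := by
      rcases o6 with h | h | h
      · subst h
        have := u5 _ (hs _ _ r6); omega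
      · exact h
      · subst h
        have := uz _ (hs _ _ r6); omega
    subst e6
    have key : ∀ k, 7 + k ≤ m+6 → R (6 + k) (7 + k) := by
      intro k
      induction k with
      | zero => intro _; exact r6
      | succ k ih =>
        intro hk
        have h1 := hs _ _ (ih (by omega))
        obtain ⟨c, hc, hc', -⟩ := hex _ _ h1
        rcases oy (7+k) c (by omega) (by omega) hc' with h | h | h
        · subst h
          rw [show 6 + (k+1) = 7 + k by omega, show 7 + (k+1) = 7 + k + 1 by omega]
          exact hc'
        · omega
        · subst h
          have := uz _ (hs _ _ hc'); omega
    intro x h1 h2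
    have := hs _ _ (key (x - 7) (by omega))
    rw [show 7 + (x - 7) = x by omega] at this
    exact ⟨_, this⟩

theorem cycle_core (m : ℕ) (b : Fin (m+13)) (c : (GG m).Walk b b) (hc : c.IsCycle)
    (hX : ∀ x : Fin (m+13), ¬ (7 ≤ x.1 ∧ x.1 ≤ m+6) → x ∈ c.support)
    (y : Fin (m+13)) (hy : 7 ≤ y.1 ∧ y.1 ≤ m+6) (hyc : y ∈ c.support) :
    ∀ x : Fin (m+13), x ∈ c.support := by
  have hsupp : ∀ x : Fin (m+13), x ∈ c.support → ∃ u, c.toSubgraph.Adj x u := by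
    intro x hx
    have h2 := hc.ncard_neighborSet_toSubgraph_eq_two hx
    obtain ⟨u, v, huv, h⟩ := Set.ncard_eq_two.1 h2
    exact ⟨u, by rw [← SimpleGraph.Subgraph.mem_neighborSet, h]; simp⟩
  have hsupp' : ∀ x u, c.toSubgraph.Adj x u → x ∈ c.support := by
    intro x u h
    exact c.mem_verts_toSubgraph.1 h.fst_mem
  have main := core m (fun p q => ∃ (hp : p < m+13) (hq : q < m+13),
      c.toSubgraph.Adj ⟨p, hp⟩ ⟨q, hq⟩) (by
      rintro p q ⟨hp, hq, h⟩; exact ⟨hq, hp, h.symm⟩) (by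
      rintro p q ⟨hp, hq, h⟩; exact h.adj_sub) (by
      rintro p q ⟨hp, hq, h⟩
      have h2 := hc.ncard_neighborSet_toSubgraph_eq_two (hsupp' _ _ h)
      obtain ⟨u, v, huv, he⟩ := Set.ncard_eq_two.1 h2
      have hmem : ∀ w, c.toSubgraph.Adj ⟨p, hp⟩ w ↔ w = u ∨ w = v := by
        intro w
        rw [← SimpleGraph.Subgraph.mem_neighborSet, he]; simp
      have huv' : u.1 ≠ v.1 := fun e => huv (Fin.ext e)
      rcases (hmem _).1 h with h | h
      · refine ⟨v.1, ?_, ⟨hp, v.2, (hmem _).2 (Or.inr rfl)⟩, ?_⟩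
        · rw [← h] at huv'; exact huv'.symm
        · rintro d ⟨_, hd, hd'⟩
          rcases (hmem _).1 hd' with e | e
          · left; rw [← h] at e; exact congrArg Fin.val e
          · right; exact congrArg Fin.val e
      · refine ⟨u.1, ?_, ⟨hp, u.2, (hmem _).2 (Or.inl rfl)⟩, ?_⟩
        · rw [← h] at huv'; exact huv'
        · rintro d ⟨_, hd, hd'⟩
          rcases (hmem _).1 hd' with e | e
          · right; exact congrArg Fin.val e
          · left; rw [← h] at e; exact congrArg Fin.val e) (by
      intro p hp h
      obtain ⟨u, hu⟩ := hsupp ⟨p, hp⟩ (hX _ h)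
      exact ⟨u.1, hp, u.2, hu⟩) (by
      intro T hT hz
      have hcon := c.toSubgraph_connected
      have h1 : (⟨m+10, by omega⟩ : Fin (m+13)) ∈ c.toSubgraph.verts :=
        c.mem_verts_toSubgraph.2 (hX _ (by simp))
      have h2 : (⟨1, by omega⟩ : Fin (m+13)) ∈ c.toSubgraph.verts :=
        c.mem_verts_toSubgraph.2 (hX _ (by simp))
      obtain ⟨w⟩ := hcon.coe.preconnected ⟨_, h1⟩ ⟨_, h2⟩
      have aux : ∀ (a b : c.toSubgraph.verts) (w : c.toSubgraph.coe.Walk a b),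
          T a.1.1 → T b.1.1 := by
        intro a b w
        induction w with
        | nil => exact id
        | cons h p ih => exact fun ha => ih (hT _ _ ha ⟨_, _, h⟩)
      exact aux _ _ w hz)
    y.1 hy.1 hy.2 (by
      obtain ⟨u, hu⟩ := hsupp y hyc
      exact ⟨u.1, y.2, u.2, hu⟩)
  intro x
  by_cases hx : 7 ≤ x.1 ∧ x.1 ≤ m+6
  · obtain ⟨q, hp, hq, h⟩ := main x.1 hx.1 hx.2
    exact hsupp' _ _ h
  · exact hX x hx

/-- stmt11: for every finite nonempty set `S` of positive integers there are
infinitely many (arbitrarily large) chordal Hamiltonian graphs that are not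
`S`-cycle extendible. -/
theorem stmt11 (S : Finset ℕ) (hS : S.Nonempty) (hpos : ∀ s ∈ S, 0 < s) :
    ∀ N : ℕ, ∃ n, N ≤ n ∧ ∃ G : SimpleGraph (Fin n), IsChordal G ∧ G.IsHamiltonian ∧
      ¬ SCycleExtendible G S := by
  intro N
  obtain ⟨m, hm, hmS⟩ : ∃ m, N ≤ m ∧ ∀ s ∈ S, s < m :=
    ⟨N + S.sup id + 1, by omega, fun s hs => by
      have : s ≤ S.sup id := Finset.le_sup (f := id) hs
      omega⟩
  refine ⟨m + 13, by omega, GG m, chordal_GG m, ham_GG m, fun hext => ?_⟩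
  obtain ⟨a, p, hp, hsup⟩ := base_cycle m
  have hcompl : (p.support.toFinset)ᶜ.card = m := by
    have : (p.support.toFinset)ᶜ = (Finset.univ : Finset (Fin m)).image
        (fun i => (⟨i.1 + 7, by omega⟩ : Fin (m+13))) := by
      ext x
      simp only [Finset.mem_compl, List.mem_toFinset, hsup, Finset.mem_image, Finset.mem_univ,
        true_and, not_not]
      constructor
      · intro h
        exact ⟨⟨x.1 - 7, by omega⟩, Fin.ext (by simp; omega)⟩
      · rintro ⟨i, rfl⟩
        have := i.2
        simp
    rw [this, Finset.card_image_of_injective]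
    · simp
    · intro i j h
      simpa [Fin.ext_iff] using h
  have hcard : p.support.toFinset.card + m = m + 13 := by
    have := Finset.card_add_card_compl p.support.toFinset
    rw [hcompl, Fintype.card_fin] at this
    exact this
  obtain ⟨s, hs⟩ := hS
  obtain ⟨b, c, hc, hss, hmem⟩ := hext a p hp ⟨s, hs, by
    have := hmS s hs
    rw [Fintype.card_fin]; omega⟩
  have hsub := hss.1
  obtain ⟨y, hy, hy'⟩ := Finset.exists_of_ssubset hss
  have hall := cycle_core m b c hc (fun x hx => by
    have := hsub (List.mem_toFinset.2 ((hsup x).2 hx))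
    exact List.mem_toFinset.1 this) y (by
    rw [List.mem_toFinset, hsup] at hy'
    exact not_not.1 hy') (List.mem_toFinset.1 hy)
  have huniv : c.support.toFinset = Finset.univ := by
    ext x; simp [hall x]
  rw [huniv, Finset.card_univ, Fintype.card_fin] at hmem
  have := hmS _ hmem
  omega
end

section
/- For every t ≥ 5, there exists a Hamiltonian chordal graph that is not cycle extendible and that has a subtree-intersection representation over a tree T having exactly t − 2 branch vertices and exactly t leaves. -/
namespace CE
/-- Bit masks of the subtrees representing the vertices. -/
def Fm : Fin 15 → ℕ := ![256, 128, 512, 64, 1024, 65, 1056, 131, 6, 12, 280, 560, 670, 1151, 319]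
/-- The 15-vertex counterexample graph. -/
def Gr : SimpleGraph (Fin 15) where
  Adj a b := a ≠ b ∧ (Fm a &&& Fm b) ≠ 0
  symm := ⟨fun a b h => ⟨h.1.symm, by rw [Nat.land_comm]; exact h.2⟩⟩
  loopless := ⟨fun a h => h.1 rfl⟩
instance : DecidableRel Gr.Adj := fun a b => inferInstanceAs (Decidable (a ≠ b ∧ (Fm a &&& Fm b) ≠ 0))
def nb : List (List ℕ) := [[10, 14], [7, 12], [11, 12], [5, 13], [6, 13], [3, 7, 13, 14], [4, 11, 13, 14], [1, 5, 8, 12, 13, 14], [7, 9, 12, 13, 14], [8, 10, 12, 13, 14], [0, 9, 11, 12, 13, 14], [2, 6, 10, 12, 13, 14], [1, 2, 7, 8, 9, 10, 11, 13, 14], [3, 4, 5, 6, 7, 8, 9, 10, 11, 12, 14], [0, 5, 6, 7, 8, 9, 10, 11, 12, 13]]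
theorem nb_spec : ∀ a b : Fin 15, Gr.Adj a b → b.val ∈ nb.getD a.val [] := by decide +kernel
theorem peo : ∀ a b c : Fin 15, a < b → a < c → b ≠ c → Gr.Adj a b → Gr.Adj a c → Gr.Adj b c := by decide +kernel
def ext : ℕ → ℕ → ℕ → Bool
  | 0, cur, _ => (nb.getD cur []).contains 13
  | n+1, cur, av => (nb.getD cur []).any fun y => Nat.testBit av y && ext n y (av ^^^ 2^y)
set_option maxRecDepth 100000 in
theorem ext8 : ext 13 13 (32767 - 2^13 - 2^8) = false := by decide +kernel
set_option maxRecDepth 100000 in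
theorem ext9 : ext 13 13 (32767 - 2^13 - 2^9) = false := by decide +kernel
open SimpleGraph

theorem ext_spec : ∀ (n : ℕ) (u : Fin 15) (av : ℕ) (p : Gr.Walk u 13), p.IsPath →
    p.length = n + 1 →
    (∀ z ∈ p.support, z ≠ u → z ≠ 13 → av.testBit z.val = true) →
    ext n u.val av = true := by
  intro n
  induction n with
  | zero =>
    intro u av p _ hl _
    match p, hl with
    | .cons h q, hl =>
      have hq : q.length = 0 := by simpa using hl
      have := Walk.eq_of_length_eq_zero hq
      subst this
      have := nb_spec _ _ h
      simp only [ext, List.contains_iff_mem]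
      exact this
  | succ n ih =>
    intro u av p hp hl hs
    match p, hp, hl, hs with
    | .cons (v := y) h q, hp, hl, hs =>
      rw [Walk.cons_isPath_iff] at hp
      have hq : q.length = n + 1 := by simpa using hl
      have hy : y ≠ 13 := by
        rintro rfl
        have h1 := Walk.length_eq_zero_iff.2 (Walk.isPath_iff_nil.1 hp.1)
        omega
      simp only [ext, List.any_eq_true]
      refine ⟨y.val, nb_spec _ _ h, ?_⟩
      rw [Bool.and_eq_true]
      refine ⟨hs y (by simp) h.ne' hy, ?_⟩
      apply ih y _ q hp.1 hq
      intro z hz hzy hz13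
      rw [Nat.testBit_xor, hs z (by simp [hz]) (by rintro rfl; exact hp.2 hz) hz13,
        Nat.testBit_two_pow_of_ne (fun hh => hzy (Fin.ext hh.symm))]
      rfl

theorem chordal : IsChordal Gr := by
  intro n hn
  constructor
  intro f
  obtain ⟨k, rfl⟩ : ∃ k, n = k + 4 := ⟨n - 4, by omega⟩
  obtain ⟨i, -, hi⟩ := Finset.exists_min_image (Finset.univ : Finset (Fin (k+4))) (fun i => f i)
    ⟨0, Finset.mem_univ _⟩
  have h1 : (cycleGraph (k+4)).Adj i (i+1) := by
    rw [cycleGraph_adj]; right; simp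
  have h2 : (cycleGraph (k+4)).Adj i (i-1) := by
    rw [cycleGraph_adj]; left; simp
  have h1' := f.map_adj_iff.2 h1
  have h2' := f.map_adj_iff.2 h2
  have key : (i + 1) - (i - 1) = 2 := by
    rw [add_sub_sub_cancel]
    apply Fin.ext
    simp [Fin.val_add, Nat.mod_eq_of_lt (show 2 < k+4 by omega)]
  have key2 : (i - 1) - (i + 1) = -2 := by rw [← neg_sub, key]
  have hne2 : (2 : Fin (k+4)) ≠ 0 := by
    intro h; have := congrArg Fin.val h
    simp [Nat.mod_eq_of_lt (show 2 < k+4 by omega)] at this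
  have hne : i + 1 ≠ i - 1 := by
    intro h; rw [h, sub_self] at key; exact hne2 key.symm
  have h3 := peo (f i) (f (i+1)) (f (i-1))
    (lt_of_le_of_ne (hi _ (Finset.mem_univ _)) h1'.ne)
    (lt_of_le_of_ne (hi _ (Finset.mem_univ _)) h2'.ne)
    (fun h => hne (f.injective h)) h1' h2'
  have h4 := f.map_adj_iff.1 h3
  rw [cycleGraph_adj, key, key2] at h4
  rcases h4 with h | h
  · have := congrArg Fin.val h
    simp [Nat.mod_eq_of_lt (show 2 < k+4 by omega)] at this
  · have h5 : (3 : Fin (k+4)) = 0 := by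
      have : (3 : Fin (k+4)) = 1 + 2 := by
        apply Fin.ext
        simp [Fin.val_add, Nat.mod_eq_of_lt (show 2 < k+4 by omega),
          Nat.mod_eq_of_lt (show 3 < k+4 by omega)]
      rw [this, ← h, neg_add_cancel]
    have := congrArg Fin.val h5
    simp [Nat.mod_eq_of_lt (show 3 < k+4 by omega)] at this

def mkW (l : List (Fin 15)) : ∀ (u v : Fin 15), (u :: l).IsChain Gr.Adj → (u::l).getLast? = some v →
    Gr.Walk u v := match l with
  | [] => fun u v _ h => (Walk.nil : Gr.Walk u u).copy rfl (by simpa using h)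
  | y :: l => fun u v hc h => .cons (by simpa using (List.isChain_cons_cons.1 hc).1)
      (mkW l y v (List.isChain_cons_cons.1 hc).2 (by simpa using h))

theorem mkW_support (l : List (Fin 15)) : ∀ (u v : Fin 15) (h1 : (u :: l).IsChain Gr.Adj)
    (h2 : (u::l).getLast? = some v), (mkW l u v h1 h2).support = u :: l := by
  induction l with
  | nil => intro u v h1 h2; simp [mkW]
  | cons y l ih => intro u v h1 h2; simp [mkW, ih]

theorem mkW_cycle (l : List (Fin 15)) (u : Fin 15) (h1 : (u :: l).IsChain Gr.Adj)
    (h2 : (u::l).getLast? = some u) (hn : l.Nodup) (hl : 3 ≤ l.length) :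
    (mkW l u u h1 h2).IsCycle := by
  have hs := mkW_support l u u h1 h2
  have hlen : (mkW l u u h1 h2).length = l.length := by
    have := Walk.length_support (mkW l u u h1 h2)
    rw [hs] at this; simpa using this.symm
  generalize mkW l u u h1 h2 = w at hs hlen
  match w, hs, hlen with
  | .nil, hs, hlen => simp at hlen; omega
  | .cons h q, hs, hlen =>
    have hq : q.support = l := by simpa using hs
    have hp : q.IsPath := by rw [Walk.isPath_def, hq]; exact hn
    rw [Walk.cons_isCycle_iff]
    refine ⟨hp, fun he => ?_⟩
    have hle : q.length = 1 := by
      exact hp.length_eq_one_of_mem_edges (by rw [Sym2.eq_swap]; exact he)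
    simp at hlen; omega

theorem ham : Gr.IsHamiltonian := by
  intro _
  refine ⟨10, mkW [9,8,7,1,12,2,11,6,4,13,3,5,14,0,10] 10 10 (by decide) (by decide), ?_⟩
  rw [Walk.isHamiltonianCycle_iff_isCycle_and_support_count_tail_eq_one]
  refine ⟨mkW_cycle _ _ _ _ (by decide) (by decide), ?_⟩
  rw [mkW_support]
  decide

theorem notext : ¬ CycleExtendible Gr := by
  intro H
  have hc := mkW_cycle [0,14,6,4,13,3,5,7,1,12,2,11,10] 10 (by decide) (by decide) (by decide) (by decide)
  obtain ⟨b, c', hc', hsub, hcard⟩ := H _ _ hc (by rw [mkW_support]; decide)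
  rw [mkW_support] at hsub hcard
  have h13 : (13 : Fin 15) ∈ c'.support := by
    have := hsub.1 (show (13 : Fin 15) ∈ _ by decide)
    simpa using this
  have hcd : c'.support.toFinset.card = 14 := by rw [hcard]; decide
  have hcr := hc'.rotate h13
  have hset : ∀ z, z ∈ (c'.rotate _ h13).support ↔ z ∈ c'.support.toFinset := by
    intro z; simp
  generalize c'.rotate _ h13 = w at hcr hset
  match w, hcr, hset with
  | .nil, hcr, _ => simp at hcr
  | .cons (v := y) h q, hcr, hset =>
    rw [Walk.cons_isCycle_iff] at hcr
    have hlen : q.support.length = 14 := by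
      rw [← List.toFinset_card_of_nodup hcr.1.support_nodup]
      refine Eq.trans ?_ hcd
      congr 1
      ext z
      rw [← hset]
      simp
      rintro rfl
      simp
    have hex : ∃ x, x ∉ c'.support.toFinset := by
      by_contra hh
      push Not at hh
      rw [Finset.eq_univ_iff_forall.2 hh] at hcd
      simp at hcd
    obtain ⟨x, hx⟩ := hex
    have hx' : x = 8 ∨ x = 9 := by
      have : x ∉ (10 :: [0,14,6,4,13,3,5,7,1,12,2,11,10] : List (Fin 15)).toFinset :=
        fun h => hx (hsub.1 h)
      clear hx; revert x; decide
    have hy13 := h.ne'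
    have hyin : y ∈ c'.support.toFinset := by rw [← hset]; simp
    have gen : ext 13 13 (32767 - 2^13 - 2^x.val) = true := by
      have hbits : ∀ z : Fin 15, z ≠ x → z ≠ 13 →
          Nat.testBit (32767 - 2^13 - 2^x.val) z.val = true := by
        rcases hx' with rfl | rfl <;> decide
      simp only [ext, List.any_eq_true]
      refine ⟨y.val, nb_spec _ _ h, ?_⟩
      rw [Bool.and_eq_true]
      refine ⟨hbits y (fun e => hx (e ▸ hyin)) hy13, ?_⟩
      apply ext_spec 12 y _ q hcr.1 (by simpa using hlen)
      intro z hz hzy hz13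
      have hzx : z ≠ x := by
        rintro rfl
        exact hx ((hset _).1 (by simp [hz]))
      rw [Nat.testBit_xor, hbits z hzx hz13,
        Nat.testBit_two_pow_of_ne (fun hh => hzy (Fin.ext hh.symm))]
      rfl
    rcases hx' with rfl | rfl
    · have := ext8; simp_all
    · have := ext9; simp_all
def par (i : ℕ) : ℕ :=
  if i ≤ 5 then i - 1
  else if i = 6 then 0 else if i = 7 then 1 else if i = 8 then 3 else if i = 9 then 4
  else if i = 10 then 5
  else if i % 2 = 1 then i - 1 else i - 2

theorem par_lt (i : ℕ) (h : i ≠ 0) : par i < i := by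
  unfold par; split_ifs <;> omega

/-- The decomposition tree: node `i ≠ 0` is joined to `par i`. -/
def Tr (m : ℕ) : SimpleGraph (Fin m) where
  Adj i j := i.val ≠ j.val ∧ (par i = j ∨ par j = i)
  symm := ⟨fun _ _ h => ⟨h.1.symm, h.2.symm⟩⟩
  loopless := ⟨fun _ h => h.1 rfl⟩

theorem Tr_induce_connected (m : ℕ) (S : Set (Fin m)) (r : Fin m) (hr : r ∈ S)
    (h : ∀ x ∈ S, x ≠ r → x.val ≠ 0 ∧ ∃ y ∈ S, y.val = par x) : ((Tr m).induce S).Connected := by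
  rw [connected_iff_exists_forall_reachable]
  refine ⟨⟨r, hr⟩, ?_⟩
  have key : ∀ (n : ℕ) (x : Fin m) (hx : x ∈ S), x.val = n →
      ((Tr m).induce S).Reachable ⟨r, hr⟩ ⟨x, hx⟩ := by
    intro n
    induction n using Nat.strong_induction_on with
    | _ n ih =>
      intro x hx hxn
      by_cases hxr : x = r
      · subst hxr; exact Reachable.refl _
      · obtain ⟨h0, y, hy, hyp⟩ := h x hx hxr
        have hlt := par_lt x h0
        refine (ih y.val (by omega) y hy rfl).trans (Adj.reachable ?_)
        simp only [comap_adj, Function.Embedding.subtype_apply]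
        exact ⟨by omega, Or.inr hyp.symm⟩
  rintro ⟨x, hx⟩
  exact key _ x hx rfl

theorem Tr_connected (m : ℕ) (hm : 0 < m) : (Tr m).Connected := by
  have h := Tr_induce_connected m Set.univ ⟨0, hm⟩ trivial (fun x _ hx => by
    have : x.val ≠ 0 := fun hh => hx (Fin.ext hh)
    have h2 := par_lt x this
    exact ⟨this, ⟨par x, by omega⟩, trivial, rfl⟩)
  exact (induceUnivIso (Tr m)).connected_iff.1 h

theorem Tr_isTree (m : ℕ) (hm : 0 < m) : (Tr m).IsTree := by
  classical
  have hc := Tr_connected m hm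
  rw [isTree_iff_connected_and_card]
  refine ⟨hc, le_antisymm ?_ hc.card_vert_le_card_edgeSet_add_one⟩
  have hp : ∀ i : Fin m, par i < m := fun i => by
    by_cases h : i.val = 0
    · rw [h]; simpa [par] using hm
    · have := par_lt i h; omega
  have hsub : (Tr m).edgeSet ⊆
      (((Finset.univ.erase (⟨0, hm⟩ : Fin m)).image fun i => s(i, (⟨par i, hp i⟩ : Fin m)) :
        Finset (Sym2 (Fin m))) : Set (Sym2 (Fin m))) := by
    intro e
    induction e using Sym2.ind with
    | _ a b =>
      intro hab
      rw [mem_edgeSet] at hab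
      obtain ⟨hne, h⟩ := hab
      simp only [Finset.coe_image, Set.mem_image, Finset.mem_coe, Finset.mem_erase,
        Finset.mem_univ, and_true]
      have z : par 0 = 0 := rfl
      rcases h with h | h
      · refine ⟨a, fun h0 => ?_, ?_⟩
        · rw [h0] at h hne; simp only [z] at h hne; omega
        · have : (⟨par a, hp a⟩ : Fin m) = b := Fin.ext h
          rw [this]
      · refine ⟨b, fun h0 => ?_, ?_⟩
        · rw [h0] at h hne; simp only [z] at h hne; omega
        · have : (⟨par b, hp b⟩ : Fin m) = a := Fin.ext h
          rw [this, Sym2.eq_swap]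
  have h1 := Set.ncard_le_ncard hsub (Finset.finite_toSet _)
  rw [Set.ncard_coe_finset] at h1
  have h2 := h1.trans Finset.card_image_le
  rw [Finset.card_erase_of_mem (Finset.mem_univ _), Finset.card_univ, Fintype.card_fin] at h2
  rw [Nat.card_eq_fintype_card (α := Fin m), Fintype.card_fin, Nat.card_coe_set_eq]
  omega

theorem ncard_val (m : ℕ) (S : Set (Fin m)) (R : Finset ℕ)
    (h : ∀ j, j ∈ R ↔ ∃ hj : j < m, (⟨j, hj⟩ : Fin m) ∈ S) : S.ncard = R.card := by
  rw [← Set.ncard_image_of_injective S Fin.val_injective, ← Set.ncard_coe_finset]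
  congr 1
  ext j
  rw [Finset.mem_coe, h]
  constructor
  · rintro ⟨x, hx, rfl⟩; exact ⟨x.2, hx⟩
  · rintro ⟨hj, hx⟩; exact ⟨_, hx, rfl⟩

theorem par_cases (i : ℕ) : (i ≤ 5 ∧ par i = i - 1) ∨ (i = 6 ∧ par i = 0) ∨ (i = 7 ∧ par i = 1) ∨
    (i = 8 ∧ par i = 3) ∨ (i = 9 ∧ par i = 4) ∨ (i = 10 ∧ par i = 5) ∨
    (11 ≤ i ∧ i % 2 = 1 ∧ par i = i - 1) ∨ (12 ≤ i ∧ i % 2 = 0 ∧ par i = i - 2) := by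
  unfold par; split_ifs <;> omega

/-- Degrees in the tree with `11 + 2 * s` nodes. -/
def dg (s v : ℕ) : ℕ :=
  if v = 0 ∨ v = 2 ∨ v = 5 then 2 else if v < 5 then 3 else if v < 10 then 1
  else if v % 2 = 1 then 1 else if v = 10 + 2 * s then 1 else 3

def nbr (s v : ℕ) : Finset ℕ :=
  if v = 0 then {1, 6} else if v = 1 then {0, 2, 7} else if v = 2 then {1, 3}
  else if v = 3 then {2, 4, 8} else if v = 4 then {3, 5, 9} else if v = 5 then {4, 10}
  else if v < 10 then {par v}
  else if v % 2 = 1 then {par v} else if v = 10 + 2 * s then {par v}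
  else {par v, v + 1, v + 2}

theorem nbr_card (s v : ℕ) : (nbr s v).card = dg s v := by
  by_cases h : v < 6
  · interval_cases v <;> rfl
  · unfold nbr dg
    have := par_lt v (by omega)
    split_ifs <;> first | omega | rfl | skip
    rw [Finset.card_eq_three]
    exact ⟨_, _, _, by omega, by omega, by omega, rfl⟩

theorem degree_eq (s : ℕ) (v : Fin (11 + 2 * s)) :
    ((Tr (11 + 2 * s)).neighborSet v).ncard = dg s v := by
  rw [ncard_val _ _ (nbr s v), nbr_card]
  intro j
  obtain ⟨v, hv⟩ := v
  simp only [mem_neighborSet, Tr, exists_prop, nbr]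
  have a := par_cases v
  have b := par_cases j
  generalize par v = pv at a ⊢
  generalize par j = pj at b ⊢
  split_ifs <;> simp only [Finset.mem_insert, Finset.mem_singleton] <;> omega

theorem leaves (s : ℕ) :
    {v | ((Tr (11 + 2 * s)).neighborSet v).ncard = 1}.ncard = s + 5 := by
  have hinj : Function.Injective (fun k : ℕ => 11 + 2 * k) := fun a b h => by
    simp only at h; omega
  rw [ncard_val _ _ (insert 6 (insert 7 (insert 8 (insert 9 (insert (10 + 2 * s)
    ((Finset.range s).image fun k => 11 + 2 * k))))))]
  · rw [Finset.card_insert_of_notMem, Finset.card_insert_of_notMem, Finset.card_insert_of_notMem,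
      Finset.card_insert_of_notMem, Finset.card_insert_of_notMem,
      Finset.card_image_of_injective _ hinj, Finset.card_range] <;>
    simp only [Finset.mem_insert, Finset.mem_image, Finset.mem_range, not_or, not_exists,
        not_and] <;> (repeat' apply And.intro) <;> intros <;> omega
  · intro j
    simp only [Set.mem_ofPred_eq, degree_eq, exists_prop, Finset.mem_insert, Finset.mem_image,
      Finset.mem_range]
    constructor
    · rintro (h | h | h | h | h | ⟨k, hk, h⟩) <;> refine ⟨by omega, ?_⟩ <;>
        unfold dg <;> split_ifs <;> omega
    · rintro ⟨h1, h2⟩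
      by_cases hj : 11 ≤ j ∧ j % 2 = 1
      · right; right; right; right; right
        exact ⟨(j - 11) / 2, by omega, by omega⟩
      · unfold dg at h2
        split_ifs at h2 <;> omega

theorem branches (s : ℕ) :
    {v | 3 ≤ ((Tr (11 + 2 * s)).neighborSet v).ncard}.ncard = s + 3 := by
  have hinj : Function.Injective (fun k : ℕ => 10 + 2 * k) := fun a b h => by
    simp only at h; omega
  rw [ncard_val _ _ (insert 1 (insert 3 (insert 4
    ((Finset.range s).image fun k => 10 + 2 * k))))]
  · rw [Finset.card_insert_of_notMem, Finset.card_insert_of_notMem, Finset.card_insert_of_notMem,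
      Finset.card_image_of_injective _ hinj, Finset.card_range] <;>
    simp only [Finset.mem_insert, Finset.mem_image, Finset.mem_range, not_or, not_exists,
        not_and] <;> (repeat' apply And.intro) <;> intros <;> omega
  · intro j
    simp only [Set.mem_ofPred_eq, degree_eq, exists_prop, Finset.mem_insert, Finset.mem_image,
      Finset.mem_range]
    constructor
    · rintro (h | h | h | ⟨k, hk, h⟩) <;> refine ⟨by omega, ?_⟩ <;>
        unfold dg <;> split_ifs <;> omega
    · rintro ⟨h1, h2⟩
      by_cases hj : 10 ≤ j ∧ j % 2 = 0
      · right; right; right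
        unfold dg at h2
        split_ifs at h2 <;> first | omega | skip
        exact ⟨(j - 10) / 2, by omega, by omega⟩
      · unfold dg at h2
        split_ifs at h2 <;> omega

def rt : Fin 15 → ℕ := ![8, 7, 9, 6, 10, 0, 5, 0, 1, 2, 3, 4, 1, 0, 0]

theorem bit_lt (a : Fin 15) (j : ℕ) (h : (Fm a).testBit j = true) : j < 11 := by
  by_contra hj
  have h1 : Fm a < 2 ^ 11 := by clear h; revert a; decide
  have h2 : Fm a < 2 ^ j := lt_of_lt_of_le h1 (Nat.pow_le_pow_right (by norm_num) (by omega))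
  rw [Nat.testBit_lt_two_pow h2] at h
  cases h

theorem rt_spec : ∀ a : Fin 15, (Fm a).testBit (rt a) = true := by decide +kernel

theorem subtree_spec : ∀ a : Fin 15, ∀ x : Fin 11, (Fm a).testBit x.val = true → x.val ≠ rt a →
    x.val ≠ 0 ∧ (Fm a).testBit (par x.val) = true := by decide +kernel

theorem inter_spec : ∀ a b : Fin 15, (Fm a &&& Fm b) ≠ 0 ↔
    ∃ x : Fin 11, (Fm a).testBit x.val = true ∧ (Fm b).testBit x.val = true := by decide +kernel

end CE

/-- stmt14: for every `t ≥ 5` there is a Hamiltonian chordal graph `G`, not cycle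
extendible, together with a subtree-intersection representation (`Gavril`) over a
tree `T` having exactly `t` leaves and exactly `t - 2` branch vertices. -/
theorem stmt14 (t : ℕ) (ht : 5 ≤ t) :
    ∃ (n : ℕ) (G : SimpleGraph (Fin n)) (m : ℕ) (T : SimpleGraph (Fin m))
      (F : Fin n → Set (Fin m)),
      T.IsTree ∧ IsChordal G ∧ G.IsHamiltonian ∧ ¬ CycleExtendible G ∧
      (∀ a, (F a).Nonempty ∧ (T.induce (F a)).Connected) ∧
      (∀ a b, G.Adj a b ↔ a ≠ b ∧ (F a ∩ F b).Nonempty) ∧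
      {v | (T.neighborSet v).ncard = 1}.ncard = t ∧
      {v | 3 ≤ (T.neighborSet v).ncard}.ncard = t - 2 := by
  classical
  obtain ⟨s, rfl⟩ : ∃ s, t = s + 5 := ⟨t - 5, by omega⟩
  refine ⟨15, CE.Gr, 11 + 2 * s, CE.Tr (11 + 2 * s),
    fun a => {j | (CE.Fm a).testBit j.val = true}, CE.Tr_isTree _ (by omega), CE.chordal, ?_, ?_,
    ?_, ?_, CE.leaves s, ?_⟩
  · convert CE.ham
  · convert CE.notext
  · intro a
    have hr := CE.rt_spec a
    have hlt := CE.bit_lt a _ hr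
    refine ⟨⟨⟨CE.rt a, by omega⟩, hr⟩, ?_⟩
    apply CE.Tr_induce_connected _ _ ⟨CE.rt a, by omega⟩ hr
    intro x hx hxr
    have hx11 := CE.bit_lt a _ hx
    have h := CE.subtree_spec a ⟨x.val, hx11⟩ hx (fun hh => hxr (Fin.ext hh))
    have h2 : CE.par x.val < 11 := CE.bit_lt a _ h.2
    exact ⟨h.1, ⟨CE.par x.val, by omega⟩, h.2, rfl⟩
  · intro a b
    refine and_congr_right fun _ => ?_
    rw [CE.inter_spec]
    constructor
    · rintro ⟨x, h1, h2⟩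
      exact ⟨⟨x.val, by omega⟩, h1, h2⟩
    · rintro ⟨x, h1, h2⟩
      exact ⟨⟨x.val, CE.bit_lt a _ h1⟩, h1, h2⟩
  · rw [CE.branches s]; omega
end
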